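/- arXiv:1601.02771 — 2 statements merged into one kernel-verified Lean document; each statement's English description precedes it below -/
import Mathlib

section
/- Let A be a finite alphabet, a ∈ A, σ a morphism of A* prolongable on a with all letters of A occurring in σ^ω(a), and let θ be the spectral radius of the incidence matrix M_σ. Then there exist a nonnegative integer k and positive reals c₁, c₂ such that c₁ nᵏ θⁿ < |σⁿ(a)| < c₂ nᵏ θⁿ for every positive integer n. -/
/-- `w` is a prefix of the infinite word `a`. -/
def IsPrefOf {A : Type*} (w : List A) (a : ℕ → A) : Prop :=
  ∀ i : Fin w.length, w.get i = a i

/-- Fractional power `V^α`: `V^⌊α⌋` followed by the prefix of `V`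
of length `⌈{α}·|V|⌉`. -/
noncomputable def fracPow {A : Type*} (V : List A) (α : ℝ) : List A :=
  (List.replicate ⌊α⌋₊ V).flatten ++ V.take ⌈Int.fract α * V.length⌉₊

/-- The set of admissible exponents in the definition of the Diophantine exponent. -/
def dioSet {A : Type*} (a : ℕ → A) : Set ℝ :=
  {ρ | ∀ N : ℕ, ∃ (U V : List A) (α : ℝ), V ≠ [] ∧ 1 ≤ α ∧
    IsPrefOf (U ++ fracPow V α) a ∧ N ≤ (U ++ fracPow V α).length ∧
    ρ ≤ ((U ++ fracPow V α).length : ℝ) / ((U.length : ℝ) + (V.length : ℝ))}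

/-- Diophantine exponent of an infinite word. -/
noncomputable def dio {A : Type*} (a : ℕ → A) : EReal :=
  sSup ((fun ρ : ℝ => (ρ : EReal)) '' dioSet a)

/-- Action of a morphism (given by its values on letters) on a finite word. -/
def mapW {A : Type*} (σ : A → List A) (w : List A) : List A := w.flatMap σ

/-- `n`-th iterate of a morphism applied to a word. -/
def iterW {A : Type*} (σ : A → List A) (n : ℕ) (w : List A) : List A :=
  (mapW σ)^[n] w

/-- `σ` is prolongable on the letter `a`. -/
def Prolongable {A : Type*} (σ : A → List A) (a : A) : Prop :=
  (∃ W : List A, W ≠ [] ∧ σ a = a :: W) ∧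
  Filter.Tendsto (fun n => (iterW σ n [a]).length) Filter.atTop Filter.atTop

/-- The letter `b` has maximal growth for `σ`. -/
def MaxGrowth {A : Type*} (σ : A → List A) (b : A) : Prop :=
  ∃ C : ℝ, ∀ c : A, ∀ n : ℕ, 1 ≤ n →
    ((iterW σ n [c]).length : ℝ) < C * ((iterW σ n [b]).length : ℝ)

/-- Incidence matrix of a morphism, viewed over `ℂ`. -/
noncomputable def incMat {A : Type*} [Fintype A] [DecidableEq A]
    (σ : A → List A) : Matrix A A ℂ :=
  fun i j => ((σ j).count i : ℂ)

/-- Spectral radius of the incidence matrix of a morphism. -/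
noncomputable def specRad {A : Type*} [Fintype A] [DecidableEq A]
    (σ : A → List A) : ℝ :=
  sSup ((fun μ : ℂ => ‖μ‖) '' spectrum ℂ (incMat σ))


open Filter Asymptotics

section LinearGrowth

variable {E : Type*} [NormedAddCommGroup E] [NormedSpace ℂ E]

theorem Module.End.pow_apply_eq_sum_choose {T : Module.End ℂ E} {μ : ℂ} {v : E} {K : ℕ}
    (hv : ((T - μ • 1) ^ K) v = 0) (n : ℕ) :
    (T ^ n) v = ∑ m ∈ Finset.range K,
      ((n.choose m : ℂ) * μ ^ (n - m)) • ((T - μ • 1) ^ m) v := by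
  have hzero : ∀ m, K ≤ m → ((T - μ • 1) ^ m) v = 0 := fun m hm ↦ by
    rw [← Nat.sub_add_cancel hm, pow_add, Module.End.mul_apply, hv, map_zero]
  have hcomm : Commute (T - μ • 1) (μ • (1 : Module.End ℂ E)) :=
    (Commute.one_right _).smul_right μ
  have hexp : (T ^ n) v = ∑ m ∈ Finset.range (n + 1),
      ((n.choose m : ℂ) * μ ^ (n - m)) • ((T - μ • 1) ^ m) v := by
    conv_lhs => rw [← sub_add_cancel T (μ • 1), hcomm.add_pow, LinearMap.sum_apply]
    refine Finset.sum_congr rfl fun m _ ↦ ?_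
    rw [smul_pow, one_pow, mul_smul_comm, mul_one, smul_mul_assoc, ← Nat.cast_comm,
      ← nsmul_eq_mul, LinearMap.smul_apply, LinearMap.smul_apply, mul_comm, mul_smul,
      Nat.cast_smul_eq_nsmul]
  rw [hexp]
  refine (Finset.sum_subset (Finset.range_subset_range.2 (le_max_left _ K)) ?_).trans
    (Finset.sum_subset (Finset.range_subset_range.2 (le_max_right (n + 1) K)) ?_).symm
  · intro m _ hm
    rw [Nat.choose_eq_zero_of_lt (by simpa using hm)]
    simp
  · intro m _ hm
    rw [hzero m (by simpa using hm), smul_zero]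

theorem isTheta_choose_mul_pow_sub {μ : ℂ} (hμ : μ ≠ 0) (m : ℕ) :
    (fun n : ℕ ↦ (n.choose m : ℂ) * μ ^ (n - m)) =Θ[atTop]
      fun n : ℕ ↦ (n : ℝ) ^ m * ‖μ‖ ^ n := by
  refine IsTheta.mul ?_ ?_
  · have h := isTheta_choose m
    refine IsTheta.trans (IsTheta.of_norm_left ?_) h
    simpa using (isTheta_refl (fun n : ℕ ↦ (n.choose m : ℝ)) atTop)
  · have h : (fun n : ℕ ↦ μ ^ (n - m)) =ᶠ[atTop] fun n ↦ (μ ^ m)⁻¹ * μ ^ n := by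
      filter_upwards [eventually_ge_atTop m] with n hn
      rw [pow_sub₀ _ hμ hn, mul_comm]
    refine h.trans_isTheta ((isTheta_const_mul_left (inv_ne_zero (pow_ne_zero m hμ))).2 ?_)
    exact IsTheta.of_norm_left (by simpa using isTheta_refl (fun n : ℕ ↦ ‖μ‖ ^ n) atTop)

theorem isLittleO_choose_mul_pow_sub {μ : ℂ} {r : ℝ} (hμ : ‖μ‖ < r) (m : ℕ) :
    (fun n : ℕ ↦ (n.choose m : ℂ) * μ ^ (n - m)) =o[atTop] fun n : ℕ ↦ r ^ n := by
  rcases eq_or_ne μ 0 with rfl | h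
  · have h : (fun n : ℕ ↦ (n.choose m : ℂ) * 0 ^ (n - m)) =ᶠ[atTop] fun _ ↦ 0 := by
      filter_upwards [eventually_gt_atTop m] with n hn
      rw [zero_pow (by lia), mul_zero]
    exact h.trans_isLittleO (isLittleO_zero _ _)
  · exact (isTheta_choose_mul_pow_sub h m).isBigO.trans_isLittleO
      (isLittleO_pow_const_mul_const_pow_const_pow_of_norm_lt m (by simpa using hμ))

theorem isLittleO_natCast_pow_mul_pow (r : ℝ) {m k : ℕ} (h : m < k) :
    (fun n : ℕ ↦ (n : ℝ) ^ m * r ^ n) =o[atTop] fun n : ℕ ↦ (n : ℝ) ^ k * r ^ n :=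
  ((isLittleO_pow_pow_atTop_of_lt h).comp_tendsto tendsto_natCast_atTop_atTop).mul_isBigO
    (isBigO_refl _ _)

theorem isLittleO_smul_const {f : ℕ → ℂ} {g : ℕ → ℝ} (h : f =o[atTop] g) (v : E) :
    (fun n ↦ f n • v) =o[atTop] g := by
  simpa using h.smul_isBigO (isBigO_const_const v (one_ne_zero (α := ℝ)) atTop)

theorem isBigO_smul_const {f : ℕ → ℂ} {g : ℕ → ℝ} (h : f =O[atTop] g) (v : E) :
    (fun n ↦ f n • v) =O[atTop] g := by
  simpa using h.smul (isBigO_const_const v (one_ne_zero (α := ℝ)) atTop)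

namespace Module.End

theorem isLittleO_pow_apply_of_mem_maxGenEigenspace {T : Module.End ℂ E} {μ : ℂ} {v : E}
    (hv : v ∈ T.maxGenEigenspace μ) {r : ℝ} (hμ : ‖μ‖ < r) :
    (fun n ↦ (T ^ n) v) =o[atTop] fun n : ℕ ↦ r ^ n := by
  obtain ⟨K, hK⟩ := (mem_maxGenEigenspace _ _ _).1 hv
  simp_rw [pow_apply_eq_sum_choose hK]
  exact IsLittleO.fun_sum fun m _ ↦ isLittleO_smul_const (isLittleO_choose_mul_pow_sub hμ m) _

theorem isBigO_pow_apply {T : Module.End ℂ E} {μ : ℂ} (hμ : μ ≠ 0) {v : E} {k : ℕ}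
    (hv : ((T - μ • 1) ^ (k + 1)) v = 0) :
    (fun n ↦ (T ^ n) v) =O[atTop] fun n : ℕ ↦ (n : ℝ) ^ k * ‖μ‖ ^ n := by
  simp_rw [pow_apply_eq_sum_choose hv]
  refine IsBigO.fun_sum fun m hm ↦ isBigO_smul_const ?_ _
  refine (isTheta_choose_mul_pow_sub hμ m).isBigO.trans ?_
  rcases (Nat.lt_succ_iff.1 (Finset.mem_range.1 hm)).lt_or_eq with h | rfl
  · exact (isLittleO_natCast_pow_mul_pow ‖μ‖ h).isBigO
  · exact isBigO_refl _ _

theorem isBigO_of_pow_apply_ne_zero {T : Module.End ℂ E} {μ : ℂ} (hμ : μ ≠ 0) {v : E} {k : ℕ}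
    (hv : ((T - μ • 1) ^ (k + 1)) v = 0) (hv' : ((T - μ • 1) ^ k) v ≠ 0) :
    (fun n : ℕ ↦ (n : ℝ) ^ k * ‖μ‖ ^ n) =O[atTop] fun n ↦ (T ^ n) v := by
  simp_rw [pow_apply_eq_sum_choose hv, Finset.sum_range_succ]
  have hlead : (fun n : ℕ ↦ (n : ℝ) ^ k * ‖μ‖ ^ n) =O[atTop] fun n : ℕ ↦
      ((n.choose k : ℂ) * μ ^ (n - k)) • ((T - μ • 1) ^ k) v := by
    refine (isTheta_choose_mul_pow_sub hμ k).isBigO_symm.trans ?_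
    refine IsBigO.of_bound ‖((T - μ • 1) ^ k) v‖⁻¹ (Eventually.of_forall fun n ↦ ?_)
    rw [norm_smul, mul_left_comm, inv_mul_cancel₀ (norm_ne_zero_iff.2 hv'), mul_one]
  refine hlead.trans (IsLittleO.right_isBigO_add (IsLittleO.fun_sum fun m hm ↦ ?_))
  refine IsLittleO.trans_isBigO (isLittleO_smul_const ?_ _) hlead
  exact (isTheta_choose_mul_pow_sub hμ m).isBigO.trans_isLittleO
    (isLittleO_natCast_pow_mul_pow ‖μ‖ (Finset.mem_range.1 hm))

variable [FiniteDimensional ℂ E]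

theorem hasEigenvalue_of_mem_maxGenEigenspace {T : Module.End ℂ E} {μ : ℂ} {v : E}
    (hv : v ∈ T.maxGenEigenspace μ) (h0 : v ≠ 0) : T.HasEigenvalue μ := by
  rw [maxGenEigenspace_eq_genEigenspace_finrank] at hv
  refine hasEigenvalue_of_hasGenEigenvalue (k := Module.finrank ℂ E) fun h ↦ h0 ?_
  simpa [h] using hv

/-- An operator of a finite-dimensional complex space whose eigenvalues all have modulus less
than `r` has powers of growth `o(r ^ n)`. -/
theorem isLittleO_pow_apply_of_forall_lt {T : Module.End ℂ E} {r : ℝ}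
    (hr : ∀ μ, T.HasEigenvalue μ → ‖μ‖ < r) (v : E) :
    (fun n ↦ (T ^ n) v) =o[atTop] fun n : ℕ ↦ r ^ n := by
  have hv : v ∈ ⨆ μ, T.maxGenEigenspace μ := by simp [iSup_maxGenEigenspace_eq_top]
  induction hv using Submodule.iSup_induction' with
  | mem μ x hx =>
    rcases eq_or_ne x 0 with rfl | h0
    · simp
    · exact isLittleO_pow_apply_of_mem_maxGenEigenspace hx
        (hr μ (hasEigenvalue_of_mem_maxGenEigenspace hx h0))
  | zero => simp
  | add x y _ _ hx hy => simpa using hx.add hy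

/-- The powers of an operator with positive spectral radius `ρ` have exact growth
`n ^ k * ρ ^ n` for some `k`. -/
theorem exists_growth_exponent {T : Module.End ℂ E} {ρ : ℝ} (hρ : 0 < ρ)
    (hle : ∀ μ, T.HasEigenvalue μ → ‖μ‖ ≤ ρ) (hex : ∃ μ, T.HasEigenvalue μ ∧ ‖μ‖ = ρ) :
    ∃ k : ℕ, (∀ v, (fun n ↦ (T ^ n) v) =O[atTop] fun n : ℕ ↦ (n : ℝ) ^ k * ρ ^ n) ∧
      ∃ v, (fun n : ℕ ↦ (n : ℝ) ^ k * ρ ^ n) =O[atTop] fun n ↦ (T ^ n) v := by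
  classical
  let P : ℕ → Prop := fun k ↦
    ∃ μ v, ‖μ‖ = ρ ∧ v ∈ T.maxGenEigenspace μ ∧ ((T - μ • 1) ^ k) v ≠ 0
  have hP0 : P 0 := by
    obtain ⟨μ, hμ, hμρ⟩ := hex
    obtain ⟨v, hv⟩ := hμ.exists_hasEigenvector
    exact ⟨μ, v, hμρ, eigenspace_le_maxGenEigenspace hv.1, by simpa using hv.2⟩
  have hPlt : ∀ k, P k → k ≤ Module.finrank ℂ E := by
    rintro k ⟨μ, v, -, hv, hne⟩
    by_contra! hlt
    rw [maxGenEigenspace_eq_genEigenspace_finrank, mem_genEigenspace_nat,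
      LinearMap.mem_ker] at hv
    rw [← Nat.sub_add_cancel hlt.le, pow_add, mul_apply, hv, map_zero] at hne
    exact hne rfl
  set k := Nat.findGreatest P (Module.finrank ℂ E)
  have hPk : P k := Nat.findGreatest_spec (Nat.zero_le _) hP0
  have hPk' : ¬ P (k + 1) := fun h ↦
    (Nat.lt_succ_self k).not_ge (Nat.le_findGreatest (hPlt _ h) h)
  have hker : ∀ μ v, ‖μ‖ = ρ → v ∈ T.maxGenEigenspace μ → ((T - μ • 1) ^ (k + 1)) v = 0 :=
    fun μ v hμ hv ↦ by_contra fun h ↦ hPk' ⟨μ, v, hμ, hv, h⟩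
  have hne : ∀ μ : ℂ, ‖μ‖ = ρ → μ ≠ 0 := fun μ hμ ↦ norm_pos_iff.1 (hμ ▸ hρ)
  refine ⟨k, fun v ↦ ?_, ?_⟩
  · have hv : v ∈ ⨆ μ, T.maxGenEigenspace μ := by simp [iSup_maxGenEigenspace_eq_top]
    induction hv using Submodule.iSup_induction' with
    | mem μ x hx =>
      rcases eq_or_ne x 0 with rfl | h0
      · simpa using isBigO_zero _ _
      rcases (hle μ (hasEigenvalue_of_mem_maxGenEigenspace hx h0)).lt_or_eq with h | h
      · refine (isLittleO_pow_apply_of_mem_maxGenEigenspace hx h).isBigO.trans ?_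
        refine IsBigO.of_bound 1 ?_
        filter_upwards [eventually_ge_atTop 1] with n hn
        rw [norm_mul, one_mul]
        refine le_mul_of_one_le_left (norm_nonneg _) ?_
        rw [Real.norm_of_nonneg (by positivity)]
        exact one_le_pow₀ (by exact_mod_cast hn)
      · simpa [h] using isBigO_pow_apply (hne μ h) (hker μ x h hx)
    | zero => simpa using isBigO_zero _ _
    | add x y _ _ hx hy => simpa using hx.add hy
  · obtain ⟨μ, v, hμ, hv, hv'⟩ := hPk
    exact ⟨v, hμ ▸ isBigO_of_pow_apply_ne_zero (hne μ hμ) (hker μ v hμ hv) hv'⟩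

end Module.End

end LinearGrowth

section Words

variable {A : Type*} (σ : A → List A)

theorem iterW_succ (n : ℕ) (w : List A) : iterW σ (n + 1) w = mapW σ (iterW σ n w) :=
  Function.iterate_succ_apply' _ _ _

theorem iterW_comm (m n : ℕ) (w : List A) :
    iterW σ m (iterW σ n w) = iterW σ n (iterW σ m w) := by
  simp only [iterW, ← Function.iterate_add_apply, add_comm]

theorem iterW_append (n : ℕ) (v w : List A) :
    iterW σ n (v ++ w) = iterW σ n v ++ iterW σ n w := by
  induction n with
  | zero => rfl
  | succ n ih => simp [iterW_succ, ih, mapW]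

theorem length_iterW_singleton_le_of_mem {c : A} {w : List A} (hc : c ∈ w) (n : ℕ) :
    (iterW σ n [c]).length ≤ (iterW σ n w).length := by
  obtain ⟨s, t, rfl⟩ := List.append_of_mem hc
  rw [← List.singleton_append (l := t), iterW_append, iterW_append]
  simp only [List.length_append]
  lia

theorem exists_length_iterW_le [Fintype A] (m : ℕ) :
    ∃ C : ℕ, ∀ w, (iterW σ m w).length ≤ C * w.length := by
  obtain ⟨B, hB⟩ : ∃ B, ∀ c, (σ c).length ≤ B :=
    ⟨Finset.univ.sup fun c ↦ (σ c).length,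
      fun c ↦ Finset.le_sup (f := fun c ↦ (σ c).length) (Finset.mem_univ c)⟩
  have hmap : ∀ w, (mapW σ w).length ≤ B * w.length := fun w ↦ by
    induction w with
    | nil => simp [mapW]
    | cons c w ih =>
      simp only [mapW, List.flatMap_cons, List.length_append, List.length_cons] at ih ⊢
      linarith [hB c]
  refine ⟨B ^ m, fun w ↦ ?_⟩
  induction m with
  | zero => simp [iterW]
  | succ m ih =>
    rw [iterW_succ]
    calc _ ≤ B * (iterW σ m w).length := hmap _
      _ ≤ B * (B ^ m * w.length) := Nat.mul_le_mul_left _ ih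
      _ = _ := by ring

/-- The vector of letter counts of a word. -/
noncomputable def abelianization [DecidableEq A] (w : List A) : A → ℂ := fun i ↦ (w.count i : ℂ)

variable [Fintype A] [DecidableEq A]

theorem norm_abelianization_le (w : List A) : ‖abelianization w‖ ≤ w.length := by
  refine (pi_norm_le_iff_of_nonneg (by positivity)).2 fun i ↦ ?_
  simpa [abelianization] using List.count_le_length (a := i) (l := w)

theorem sum_abelianization (w : List A) : ∑ i, abelianization w i = w.length := by
  have h : ∑ i, w.count i = w.length := by
    simpa using Multiset.sum_count_eq_card (s := Finset.univ) (m := (w : Multiset A)) (by simp)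
  simp [abelianization, ← h]

theorem length_le_card_mul_norm_abelianization (w : List A) :
    (w.length : ℝ) ≤ Fintype.card A * ‖abelianization w‖ := by
  have h : (w.length : ℝ) = ‖∑ i, abelianization w i‖ := by simp [sum_abelianization]
  rw [h]
  refine (norm_sum_le_of_le _ fun i _ ↦ norm_le_pi_norm _ i).trans_eq ?_
  simp

theorem abelianization_mapW (w : List A) :
    abelianization (mapW σ w) = Matrix.toLin' (incMat σ) (abelianization w) := by
  induction w with
  | nil =>
    have : abelianization ([] : List A) = 0 := by ext; simp [abelianization]
    simp [mapW, this]
  | cons c w ih =>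
    have hcons : abelianization (c :: w) = Pi.single c 1 + abelianization w := by
      ext i
      simp only [abelianization, List.count_cons, Pi.add_apply, Pi.single_apply, beq_iff_eq,
        eq_comm (a := c)]
      split_ifs <;> simp [add_comm]
    have happ : abelianization (mapW σ (c :: w)) =
        abelianization (σ c) + abelianization (mapW σ w) := by
      ext i
      simp [abelianization, mapW]
    rw [happ, hcons, map_add, ih]
    congr 1
    ext i
    simp [abelianization, incMat]

theorem abelianization_iterW (n : ℕ) (w : List A) :
    abelianization (iterW σ n w) = (Matrix.toLin' (incMat σ) ^ n) (abelianization w) := by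
  induction n with
  | zero => simp [iterW]
  | succ n ih => rw [iterW_succ, abelianization_mapW, ih, pow_succ', Module.End.mul_apply]

theorem isBigO_length_iterW (w : List A) :
    (fun n ↦ ((iterW σ n w).length : ℝ)) =O[atTop]
      fun n ↦ (Matrix.toLin' (incMat σ) ^ n) (abelianization w) := by
  refine IsBigO.of_bound (Fintype.card A) (Eventually.of_forall fun n ↦ ?_)
  rw [← abelianization_iterW, Real.norm_natCast]
  exact length_le_card_mul_norm_abelianization _

theorem isBigO_pow_apply_length_iterW {a : A}
    (h : ∀ c, (fun n ↦ ((iterW σ n [c]).length : ℝ)) =O[atTop]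
      fun n ↦ ((iterW σ n [a]).length : ℝ)) (v : A → ℂ) :
    (fun n ↦ (Matrix.toLin' (incMat σ) ^ n) v) =O[atTop]
      fun n ↦ ((iterW σ n [a]).length : ℝ) := by
  have hv : v = ∑ c, v c • abelianization [c] := by
    ext i
    simp [abelianization, List.count_singleton, Finset.sum_apply]
  have hexp : ∀ n, (Matrix.toLin' (incMat σ) ^ n) v =
      ∑ c, v c • abelianization (iterW σ n [c]) := fun n ↦ by
    conv_lhs => rw [hv]
    simp only [map_sum, map_smul, abelianization_iterW]
  simp_rw [hexp]
  refine IsBigO.fun_sum fun c _ ↦ IsBigO.const_smul_left ?_ (v c)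
  refine IsBigO.trans (IsBigO.of_bound 1 (Eventually.of_forall fun n ↦ ?_)) (h c)
  simpa using norm_abelianization_le _

theorem finite_norm_spectrum_incMat :
    ((fun μ : ℂ ↦ ‖μ‖) '' spectrum ℂ (incMat σ)).Finite := by
  rw [← Matrix.spectrum_toLin']
  exact (Module.End.finite_spectrum _).image _

theorem norm_le_specRad {μ : ℂ} (h : Module.End.HasEigenvalue (Matrix.toLin' (incMat σ)) μ) :
    ‖μ‖ ≤ specRad σ := by
  rw [Module.End.hasEigenvalue_iff_mem_spectrum, Matrix.spectrum_toLin'] at h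
  exact le_csSup (finite_norm_spectrum_incMat σ).bddAbove ⟨μ, h, rfl⟩

theorem exists_hasEigenvalue_norm_eq_specRad [Nonempty A] :
    ∃ μ, Module.End.HasEigenvalue (Matrix.toLin' (incMat σ)) μ ∧ ‖μ‖ = specRad σ := by
  obtain ⟨ν, hν⟩ := Module.End.exists_eigenvalue (Matrix.toLin' (incMat σ))
  rw [Module.End.hasEigenvalue_iff_mem_spectrum, Matrix.spectrum_toLin'] at hν
  obtain ⟨μ, hμ, h⟩ :=
    (Set.Nonempty.image (fun μ : ℂ ↦ ‖μ‖) ⟨ν, hν⟩).csSup_mem (finite_norm_spectrum_incMat σ)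
  refine ⟨μ, ?_, h⟩
  rwa [Module.End.hasEigenvalue_iff_mem_spectrum, Matrix.spectrum_toLin']

end Words

theorem exists_forall_lt_mul_of_isBigO {f g : ℕ → ℝ} (h : f =O[atTop] g)
    (hg : ∀ n, 1 ≤ n → 0 < g n) : ∃ C > 0, ∀ n, 1 ≤ n → f n < C * g n := by
  obtain ⟨C, hC, hfg⟩ := bound_of_isBigO_nat_atTop h
  refine ⟨C + 1, by positivity, fun n hn ↦ ?_⟩
  have hle := hfg (hg n hn).ne'
  rw [Real.norm_of_nonneg (hg n hn).le] at hle
  linarith [le_abs_self (f n), Real.norm_eq_abs (f n), hg n hn]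

/-- growth estimate `c₁ n^k θ^n < |σⁿ(a)| < c₂ n^k θ^n`, where `θ` is the
spectral radius of the incidence matrix. -/
theorem stmt_2 {A : Type*} [Fintype A] [DecidableEq A] (σ : A → List A) (a : A)
    (hpro : Prolongable σ a)
    (u : ℕ → A) (hu : ∀ n : ℕ, IsPrefOf (iterW σ n [a]) u)
    (hall : ∀ c : A, ∃ i : ℕ, u i = c) :
    ∃ (k : ℕ) (c₁ c₂ : ℝ), 0 < c₁ ∧ 0 < c₂ ∧ ∀ n : ℕ, 1 ≤ n →
      c₁ * (n : ℝ) ^ k * specRad σ ^ n < ((iterW σ n [a]).length : ℝ) ∧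
      ((iterW σ n [a]).length : ℝ) < c₂ * (n : ℝ) ^ k * specRad σ ^ n := by
  have hletter : ∀ c, (fun n ↦ ((iterW σ n [c]).length : ℝ)) =O[atTop]
      fun n ↦ ((iterW σ n [a]).length : ℝ) := fun c ↦ by
    obtain ⟨i, rfl⟩ := hall c
    obtain ⟨m, hm⟩ := (hpro.2.eventually_gt_atTop i).exists
    have hmem : u i ∈ iterW σ m [a] := hu m ⟨i, hm⟩ ▸ List.get_mem _ _
    obtain ⟨C, hC⟩ := exists_length_iterW_le σ m
    refine IsBigO.of_bound C (Eventually.of_forall fun n ↦ ?_)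
    rw [Real.norm_natCast, Real.norm_natCast]
    have h := (length_iterW_singleton_le_of_mem σ hmem n).trans_eq
      (congrArg List.length (iterW_comm σ n m [a]))
    exact_mod_cast h.trans (hC _)
  have : Nonempty A := ⟨a⟩
  have hpos : 0 < specRad σ := by
    by_contra! hle
    have hsmall := Module.End.isLittleO_pow_apply_of_forall_lt (r := 1)
      (fun μ hμ ↦ ((norm_le_specRad σ hμ).trans hle).trans_lt one_pos) (abelianization [a])
    simp only [one_pow] at hsmall
    have hlim := (isLittleO_one_iff ℝ).1 ((isBigO_length_iterW σ [a]).trans_isLittleO hsmall)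
    exact not_tendsto_nhds_of_tendsto_atTop
      (tendsto_natCast_atTop_atTop.comp hpro.2) 0 hlim
  obtain ⟨k, hupper, v, hlower⟩ := Module.End.exists_growth_exponent hpos
    (fun _ ↦ norm_le_specRad σ) (exists_hasEigenvalue_norm_eq_specRad σ)
  have hlen : ∀ n, 0 < (iterW σ n [a]).length := fun n ↦ by
    obtain ⟨W, -, hW⟩ := hpro.1
    refine List.length_pos_of_mem (a := a) ?_
    induction n with
    | zero => simp [iterW]
    | succ n ih =>
      rw [iterW_succ]
      exact List.mem_flatMap.2 ⟨a, ih, by simp [hW]⟩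
  obtain ⟨c₂, hc₂, h₂⟩ := exists_forall_lt_mul_of_isBigO
    ((isBigO_length_iterW σ [a]).trans (hupper _)) fun n hn ↦ by positivity
  obtain ⟨C, hC, h₁⟩ := exists_forall_lt_mul_of_isBigO
    (hlower.trans (isBigO_pow_apply_length_iterW σ hletter v))
    fun n _ ↦ by exact_mod_cast hlen n
  refine ⟨k, C⁻¹, c₂, inv_pos.2 hC, hc₂, fun n hn ↦ ⟨?_, ?_⟩⟩
  · rw [mul_assoc, inv_mul_lt_iff₀ hC]
    exact h₁ n hn
  · rw [mul_assoc]
    exact h₂ n hn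
end

section
/- Let k ≥ 2, b ≥ 2 be integers and ξ a real number with base-b expansion 0.a₁a₂…, where a_n is the output of a deterministic k-pushdown automaton on input the base-k expansion of n. If there exist two distinct positive integers n, n' whose reached configurations C(n) and C(n') are equivalent (i.e. for every input word w the outputs after reading w from C(n) and from C(n') coincide), then ξ is either rational or transcendental. -/
/-- If `f' g = f g'` over a field of characteristic zero and `g ≠ 0`, then `f` is a constant
multiple of `g`. -/
theorem eq_C_mul_of_derivative_mul_eq {F : Type*} [Field F] [CharZero F]
    {f g : Polynomial F} (hg : g ≠ 0)
    (h : Polynomial.derivative f * g = f * Polynomial.derivative g) :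
    ∃ a : F, f = Polynomial.C a * g := by
  obtain ⟨q, r, hfr, hr⟩ : ∃ q r : Polynomial F, f = q * g + r ∧ r.degree < g.degree :=
    ⟨f / g, f % g, by rw [mul_comm]; exact (EuclideanDomain.div_add_mod f g).symm,
      Polynomial.degree_mod_lt f hg⟩
  have key : Polynomial.derivative q * g * g
      = r * Polynomial.derivative g - Polynomial.derivative r * g := by
    rw [hfr] at h
    simp only [Polynomial.derivative_add, Polynomial.derivative_mul] at h
    linear_combination h
  have hq : Polynomial.derivative q = 0 := by
    by_contra hq
    have hdeg : (Polynomial.derivative q * g * g).degree < g.degree + g.degree := by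
      rw [key]
      refine (Polynomial.degree_sub_le _ _).trans_lt (max_lt ?_ ?_)
      · rw [Polynomial.degree_mul]
        have h1 := Polynomial.degree_derivative_le (p := g)
        have hgb : g.degree ≠ ⊥ := by simpa using hg
        calc r.degree + (Polynomial.derivative g).degree ≤ r.degree + g.degree := by gcongr
          _ < g.degree + g.degree := WithBot.add_lt_add_right hgb hr
      · rw [Polynomial.degree_mul]
        have hgb : g.degree ≠ ⊥ := by simpa using hg
        exact WithBot.add_lt_add_right hgb (Polynomial.degree_derivative_le.trans_lt hr)
    rw [mul_assoc, Polynomial.degree_mul, Polynomial.degree_mul] at hdeg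
    have h0 : (0 : WithBot ℕ) ≤ (Polynomial.derivative q).degree :=
      Polynomial.zero_le_degree_iff.2 hq
    exact absurd hdeg (not_lt.2 (le_add_of_nonneg_left h0))
  obtain ⟨a, rfl⟩ : ∃ a, q = Polynomial.C a :=
    ⟨_, Polynomial.eq_C_of_derivative_eq_zero hq⟩
  refine ⟨a, ?_⟩
  rw [hfr]
  suffices r = 0 by rw [this, add_zero]
  by_contra hr0
  have hk : Polynomial.derivative r * g = r * Polynomial.derivative g := by
    rw [hq] at key; linear_combination key
  have hlt : r.natDegree < g.natDegree := Polynomial.natDegree_lt_natDegree hr0 hr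
  have hc := congrArg (fun p => Polynomial.coeff p (r.natDegree + (g.natDegree - 1))) hk
  have hg1 : 1 ≤ g.natDegree := by omega
  rw [Polynomial.coeff_mul_add_eq_of_natDegree_le le_rfl
    ((Polynomial.natDegree_derivative_le g))] at hc
  rw [Polynomial.coeff_derivative, Nat.sub_add_cancel hg1] at hc
  rcases Nat.eq_zero_or_pos r.natDegree with h0 | h0
  · obtain ⟨s, hs⟩ := Polynomial.natDegree_eq_zero.1 h0
    rw [← hs] at hc hr0
    simp only [Polynomial.derivative_C, zero_mul, Polynomial.coeff_zero] at hc
    have : (g.natDegree - 1 + 1 : F) = g.natDegree := by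
      ring
    simp only [Polynomial.natDegree_C, Polynomial.coeff_C_zero] at hc
    have h2 := (mul_eq_zero.1 hc.symm)
    rcases h2 with h2 | h2
    · exact hr0 (by rw [h2, Polynomial.C_0])
    · rcases mul_eq_zero.1 h2 with h2 | h2
      · exact hg (Polynomial.leadingCoeff_eq_zero.1 h2)
      · exact (Nat.cast_add_one_ne_zero (R := F) _) h2
  · rw [show r.natDegree + (g.natDegree - 1) = (r.natDegree - 1) + g.natDegree by omega,
      Polynomial.coeff_mul_add_eq_of_natDegree_le (Polynomial.natDegree_derivative_le r) le_rfl,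
      Polynomial.coeff_derivative, Nat.sub_add_cancel h0] at hc
    have hrl : r.coeff r.natDegree ≠ 0 := by simpa using hr0
    have hgl : g.coeff g.natDegree ≠ 0 := by simpa using hg
    have h3 : ((r.natDegree - 1 : ℕ) : F) + 1 = ((g.natDegree - 1 : ℕ) : F) + 1 := by
      apply mul_left_cancel₀ (mul_ne_zero hrl hgl)
      linear_combination hc
    have h4 : r.natDegree - 1 = g.natDegree - 1 := by
      have := add_right_cancel h3
      exact_mod_cast this
    omega

/-- In an `l`-generated space of polynomials, for all but finitely many points `c` no nonzero
member vanishes to order `l` at `c`. -/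
theorem finite_setOf_X_sub_C_pow_dvd {F : Type*} [Field F] [CharZero F] (l : ℕ) :
    ∀ v : Fin l → Polynomial F,
      {c : F | ∃ f ∈ Submodule.span F (Set.range v), f ≠ 0 ∧
        (Polynomial.X - Polynomial.C c) ^ l ∣ f}.Finite := by
  induction l with
  | zero =>
    intro v
    convert Set.finite_empty
    ext c
    simp
  | succ l ih =>
    intro v
    by_cases h0 : v 0 = 0
    · refine (ih (fun i => v i.succ)).subset ?_
      rintro c ⟨f, hf, hf0, hdvd⟩
      refine ⟨f, ?_, hf0, (pow_dvd_pow _ (Nat.le_succ l)).trans hdvd⟩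
      have : Set.range v = insert 0 (Set.range fun i : Fin l => v i.succ) := by
        rw [← h0]
        exact (Fin.range_cons (v 0) (fun i : Fin l => v i.succ) ▸
          congrArg Set.range (Fin.cons_self_tail v).symm)
      rwa [this, Submodule.span_insert_zero] at hf
    · set g := v 0 with hg
      let φ : Polynomial F →ₗ[F] Polynomial F :=
        { toFun := fun f => Polynomial.derivative f * g - f * Polynomial.derivative g
          map_add' := by intro x y; simp only [Polynomial.derivative_add]; ring
          map_smul' := by
            intro a x
            simp only [Polynomial.smul_eq_C_mul, Polynomial.derivative_C_mul, RingHom.id_apply]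
            ring }
      have hφg : φ g = 0 := by
        change Polynomial.derivative g * g - g * Polynomial.derivative g = 0
        ring
      refine ((ih (fun i => φ (v i.succ))).union
        (Polynomial.finite_setOfPred_isRoot h0)).subset ?_
      rintro c ⟨f, hf, hf0, hdvd⟩
      by_cases hφf : φ f = 0
      · right
        obtain ⟨a, rfl⟩ := eq_C_mul_of_derivative_mul_eq h0 (sub_eq_zero.1 hφf)
        have ha : a ≠ 0 := by rintro rfl; simp at hf0
        have h1 : (Polynomial.X - Polynomial.C c) ∣ Polynomial.C a * g :=
          (dvd_pow_self _ (Nat.succ_ne_zero l)).trans hdvd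
        rw [Polynomial.dvd_iff_isRoot] at h1
        simpa [Polynomial.IsRoot, ha] using h1
      · left
        refine ⟨φ f, ?_, hφf, ?_⟩
        · have h1 : φ f ∈ (Submodule.span F (Set.range v)).map φ := ⟨f, hf, rfl⟩
          rw [Submodule.map_span] at h1
          refine Submodule.span_le.2 ?_ h1
          rintro _ ⟨_, ⟨i, rfl⟩, rfl⟩
          refine Fin.cases ?_ (fun i => ?_) i
          · change φ g ∈ _
            rw [hφg]; exact Submodule.zero_mem _
          · exact Submodule.subset_span ⟨i, rfl⟩
        · obtain ⟨q, rfl⟩ := hdvd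
          refine dvd_sub (Dvd.dvd.mul_right ?_ _)
            (((pow_dvd_pow _ (Nat.le_succ l)).trans (dvd_mul_right _ _)).mul_right _)
          rw [Polynomial.derivative_mul]
          refine dvd_add (Dvd.dvd.mul_right ?_ _)
            (((pow_dvd_pow _ (Nat.le_succ l)).trans (dvd_mul_right _ _)))
          rw [Polynomial.derivative_X_sub_C_pow]
          simp

theorem X_sub_C_pow_dvd_of_taylor_coeff_eq_zero {R : Type*} [CommRing R] {f : Polynomial R}
    {c : R} {l : ℕ} (h : ∀ i < l, (Polynomial.taylor c f).coeff i = 0) :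
    (Polynomial.X - Polynomial.C c) ^ l ∣ f := by
  obtain ⟨q, hq⟩ := Polynomial.X_pow_dvd_iff.2 h
  refine ⟨Polynomial.taylor (-c) q, ?_⟩
  have := congrArg (Polynomial.taylor (-c)) hq
  rw [Polynomial.taylor_taylor, neg_add_cancel, Polynomial.taylor_zero] at this
  rw [this, Polynomial.taylor_mul, Polynomial.taylor_X_pow]
  simp [sub_eq_add_neg]

/-- In a finitely generated space of polynomials in `d + 1` variables, for all but finitely many
hyperplanes `X₀ = ∑ Aᵢ Xᵢ₊₁` no nonzero member vanishes along the hyperplane to the order given by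
the number of generators. -/
theorem finite_setOf_taylor_coeff_eq_zero {d l : ℕ} (v : Fin l → MvPolynomial (Fin (d + 1)) ℚ) :
    {A : Fin d → ℚ | ∃ f ∈ Submodule.span ℚ (Set.range v), f ≠ 0 ∧ ∀ i < l,
      (Polynomial.taylor (∑ i, MvPolynomial.C (A i) * MvPolynomial.X i)
        (MvPolynomial.finSuccEquiv ℚ d f)).coeff i = 0}.Finite := by
  let K := FractionRing (MvPolynomial (Fin d) ℚ)
  let ι : MvPolynomial (Fin d) ℚ →+* K := algebraMap _ _
  have hι : Function.Injective ι := IsFractionRing.injective _ _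
  let Φ : MvPolynomial (Fin (d + 1)) ℚ →+* Polynomial K :=
    (Polynomial.mapRingHom ι).comp (MvPolynomial.finSuccEquiv ℚ d : _ →+* _)
  have : CharZero K := charZero_of_injective_algebraMap (R := ℚ) (algebraMap ℚ K).injective
  let lin : (Fin d → ℚ) → MvPolynomial (Fin d) ℚ :=
    fun A => ∑ i, MvPolynomial.C (A i) * MvPolynomial.X i
  have hlin : Function.Injective lin := by
    intro A A' h
    ext i
    have := congrArg (MvPolynomial.coeff (Finsupp.single i 1)) h
    simpa [lin, MvPolynomial.coeff_sum, MvPolynomial.coeff_C_mul, MvPolynomial.coeff_X,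
      Finsupp.single_left_inj] using this
  have hfin := finite_setOf_X_sub_C_pow_dvd l (fun i => Φ (v i))
  refine (hfin.preimage (f := fun A => ι (lin A)) ((hι.comp hlin).injOn)).subset ?_
  rintro A ⟨f, hf, hf0, hdvd⟩
  refine ⟨Φ f, ?_, ?_, ?_⟩
  · let Ψ : MvPolynomial (Fin (d + 1)) ℚ →ₗ[ℚ] Polynomial K :=
      Φ.toAddMonoidHom.toRatLinearMap
    have h1 : Ψ f ∈ (Submodule.span ℚ (Set.range v)).map Ψ := ⟨f, hf, rfl⟩
    rw [Submodule.map_span, ← Set.range_comp] at h1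
    exact Submodule.span_subset_span ℚ K _ h1
  · intro h
    apply hf0
    have h1 : MvPolynomial.finSuccEquiv ℚ d f = 0 :=
      Polynomial.map_injective ι hι (by rw [Polynomial.map_zero]; exact h)
    simpa using h1
  · obtain ⟨q, hq⟩ := X_sub_C_pow_dvd_of_taylor_coeff_eq_zero hdvd
    refine ⟨q.map ι, ?_⟩
    change Polynomial.map ι (MvPolynomial.finSuccEquiv ℚ d f) = _
    rw [hq]
    simp [lin, Polynomial.map_sum]

/-- Exponent vectors of the monomials of degree `r` in `N` variables. -/
abbrev HomExp (N r : ℕ) : Type :=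
  {a : Fin N → ℕ // a ∈ Finset.piAntidiag (Finset.univ : Finset (Fin N)) r}

theorem HomExp.sum_eq {N r : ℕ} (a : HomExp N r) : ∑ k, a.1 k = r :=
  (Finset.mem_piAntidiag.1 a.2).1

/-- The monomial with exponents `a` along the line `v + t u`, as a polynomial in `t`. -/
noncomputable def jet {R : Type*} [CommSemiring R] {N : ℕ} (u v : Fin N → R) (a : Fin N → ℕ) :
    Polynomial R :=
  ∏ k, (Polynomial.C (v k) + Polynomial.C (u k) * Polynomial.X) ^ a k

/-- The homogeneous polynomial with given coefficients. -/
noncomputable def homPoly (N r : ℕ) : (HomExp N r → ℚ) →ₗ[ℚ] MvPolynomial (Fin N) ℚ where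
  toFun f := ∑ a, MvPolynomial.C (f a) * ∏ k, MvPolynomial.X k ^ a.1 k
  map_add' f g := by simp [add_mul, Finset.sum_add_distrib]
  map_smul' c f := by simp [MvPolynomial.smul_eq_C_mul, Finset.mul_sum, mul_assoc]

theorem homPoly_apply {N r : ℕ} (f : HomExp N r → ℚ) :
    homPoly N r f = ∑ a, MvPolynomial.C (f a) * ∏ k, MvPolynomial.X k ^ a.1 k := rfl

theorem homPoly_isHomogeneous {N r : ℕ} (f : HomExp N r → ℚ) :
    (homPoly N r f).IsHomogeneous r := by
  rw [homPoly_apply]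
  refine MvPolynomial.IsHomogeneous.sum _ _ _ fun a _ => ?_
  have h1 : (∏ k, (MvPolynomial.X k : MvPolynomial (Fin N) ℚ) ^ a.1 k).IsHomogeneous
      (∑ k, a.1 k) :=
    MvPolynomial.IsHomogeneous.prod _ _ _ fun k _ => MvPolynomial.isHomogeneous_X_pow k _
  rw [a.sum_eq] at h1
  simpa using (MvPolynomial.isHomogeneous_C (Fin N) (f a)).mul h1

theorem homPoly_injective (N r : ℕ) : Function.Injective (homPoly N r) := by
  rw [injective_iff_map_eq_zero]
  intro f hf
  ext a
  have h1 := congrArg (MvPolynomial.coeff (Finsupp.equivFunOnFinite.symm a.1)) hf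
  have h2 : ∀ b : HomExp N r, (∏ k, (MvPolynomial.X k : MvPolynomial (Fin N) ℚ) ^ b.1 k)
      = MvPolynomial.monomial (Finsupp.equivFunOnFinite.symm b.1) 1 := by
    intro b
    rw [MvPolynomial.monomial_eq, Finsupp.prod_fintype _ _ (by simp)]
    simp
  rw [homPoly_apply, MvPolynomial.coeff_sum] at h1
  simpa [h2, MvPolynomial.coeff_C_mul, MvPolynomial.coeff_monomial, Subtype.val_inj] using h1

theorem aeval_homPoly {N r : ℕ} {R : Type*} [CommRing R] [Algebra ℚ R] (f : HomExp N r → ℚ)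
    (y : Fin N → R) :
    MvPolynomial.aeval y (homPoly N r f) = ∑ a, algebraMap ℚ R (f a) * ∏ k, y k ^ a.1 k := by
  simp [homPoly_apply]

theorem finSuccEquiv_C {d : ℕ} (q : ℚ) : MvPolynomial.finSuccEquiv ℚ d (MvPolynomial.C q) =
    Polynomial.C (MvPolynomial.C q) :=
  (MvPolynomial.finSuccEquiv ℚ d).commutes q

/-- The linear substitution attached to an invertible matrix is injective. -/
theorem aeval_linear_injective {d : ℕ} (G : Matrix (Fin d) (Fin d) ℚ) (hG : G.det ≠ 0) :
    Function.Injective (MvPolynomial.aeval (R := ℚ)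
      (fun i : Fin d => ∑ j, MvPolynomial.C (G j i) * (MvPolynomial.X j :
        MvPolynomial (Fin d) ℚ))) := by
  have hinv : G⁻¹ * G = 1 := Matrix.nonsing_inv_mul G (isUnit_iff_ne_zero.2 hG)
  refine Function.LeftInverse.injective (g := MvPolynomial.aeval (R := ℚ)
      (fun j : Fin d => ∑ m, MvPolynomial.C (G⁻¹ m j) * (MvPolynomial.X m :
        MvPolynomial (Fin d) ℚ))) fun p => ?_
  rw [← AlgHom.comp_apply]
  conv_rhs => rw [← AlgHom.id_apply (R := ℚ) p]
  congr 1
  apply MvPolynomial.algHom_ext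
  intro i
  simp only [AlgHom.comp_apply, MvPolynomial.aeval_X, map_sum, map_mul, MvPolynomial.algHom_C,
    MvPolynomial.algebraMap_eq, AlgHom.id_apply, Finset.mul_sum]
  rw [Finset.sum_comm]
  have h1 : ∀ m, ∑ j, MvPolynomial.C (G j i) * (MvPolynomial.C (G⁻¹ m j) *
      (MvPolynomial.X m : MvPolynomial (Fin d) ℚ)) =
      MvPolynomial.C ((1 : Matrix (Fin d) (Fin d) ℚ) m i) * MvPolynomial.X m := by
    intro m
    rw [← hinv, Matrix.mul_apply, map_sum, Finset.sum_mul]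
    refine Finset.sum_congr rfl fun j _ => ?_
    rw [MvPolynomial.C_mul]
    ring
  rw [Finset.sum_congr rfl fun m _ => h1 m]
  simp [Matrix.one_apply]

/-- For all but finitely many hyperplanes, every nonzero form in a given finitely generated space
has a derivative of low order that does not vanish at some small integral combination of any given
basis of the hyperplane. -/
theorem exists_finite_exists_jet_ne_zero {d r l : ℕ} (w : Fin l → (HomExp (d + 1) r → ℚ)) :
    ∃ Z : Set (Fin d → ℚ), Z.Finite ∧ ∀ (A : Fin d → ℚ) (g : Fin d → Fin (d + 1) → ℚ),
      A ∉ Z → (∀ j, g j 0 = ∑ i, A i * g j i.succ) →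
      (Matrix.of fun j i : Fin d => g j i.succ).det ≠ 0 →
      ∀ f ∈ Submodule.span ℚ (Set.range w), f ≠ 0 →
        ∃ i < l, ∃ s : Fin d → Fin (r + 1),
          ∑ a, f a * (jet (Pi.single 0 1) (fun k => ∑ j, (s j : ℚ) * g j k) a.1).coeff i ≠ 0 := by
  refine ⟨_, finite_setOf_taylor_coeff_eq_zero (fun i => homPoly (d + 1) r (w i)), ?_⟩
  intro A g hA hg hdet f hf hf0
  have hF : homPoly (d + 1) r f ∈ Submodule.span ℚ (Set.range fun i => homPoly (d + 1) r (w i)) := by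
    have h1 : homPoly (d + 1) r f ∈ (Submodule.span ℚ (Set.range w)).map (homPoly (d + 1) r) :=
      ⟨f, hf, rfl⟩
    rwa [Submodule.map_span, ← Set.range_comp] at h1
  set F := homPoly (d + 1) r f with hFdef
  have hF0 : F ≠ 0 := fun h => hf0 (homPoly_injective _ _ (by rw [← hFdef, h, map_zero]))
  have hA' : ∃ i < l, (Polynomial.taylor (∑ i, MvPolynomial.C (A i) * MvPolynomial.X i)
        (MvPolynomial.finSuccEquiv ℚ d F)).coeff i ≠ 0 := by
    by_contra! h
    exact hA ⟨F, hF, hF0, h⟩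
  obtain ⟨i, hil, hi⟩ := hA'
  refine ⟨i, hil, ?_⟩
  set G : Matrix (Fin d) (Fin d) ℚ := Matrix.of fun j i : Fin d => g j i.succ with hG
  set Λ := MvPolynomial.aeval (R := ℚ)
      (fun i : Fin d => ∑ j, MvPolynomial.C (G j i) * (MvPolynomial.X j :
        MvPolynomial (Fin d) ℚ)) with hΛ
  let σ : Fin (d + 1) → MvPolynomial (Fin (d + 1)) ℚ := fun k =>
    MvPolynomial.C ((Pi.single 0 1 : Fin (d + 1) → ℚ) k) * MvPolynomial.X 0 +
      ∑ j, MvPolynomial.C (g j k) * MvPolynomial.X j.succ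
  have hcomp : MvPolynomial.finSuccEquiv ℚ d (MvPolynomial.aeval σ F) = Polynomial.map
      (Λ : MvPolynomial (Fin d) ℚ →+* MvPolynomial (Fin d) ℚ)
      (Polynomial.taylor (∑ i, MvPolynomial.C (A i) * MvPolynomial.X i)
        (MvPolynomial.finSuccEquiv ℚ d F)) := by
    have : ((MvPolynomial.finSuccEquiv ℚ d).toAlgHom.comp (MvPolynomial.aeval σ)) =
        (Polynomial.mapAlgHom Λ).comp (((Polynomial.taylorAlgHom
          (∑ i, MvPolynomial.C (A i) * MvPolynomial.X i)).restrictScalars ℚ).comp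
            (MvPolynomial.finSuccEquiv ℚ d).toAlgHom) := by
      apply MvPolynomial.algHom_ext
      intro k
      refine Fin.cases ?_ (fun k => ?_) k
      · simp [σ, hg, hΛ, hG, finSuccEquiv_C, Polynomial.taylor_X, MvPolynomial.finSuccEquiv_X_zero,
          MvPolynomial.finSuccEquiv_X_succ, Finset.mul_sum, Finset.sum_mul, Polynomial.map_sum]
        rw [Finset.sum_comm]
        refine Finset.sum_congr rfl fun i _ => Finset.sum_congr rfl fun j _ => ?_
        ring
      · simp [σ, hΛ, hG, finSuccEquiv_C, MvPolynomial.finSuccEquiv_X_succ]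
    exact DFunLike.congr_fun this F
  set Q := (MvPolynomial.finSuccEquiv ℚ d (MvPolynomial.aeval σ F)).coeff i with hQ
  have hQ0 : Q ≠ 0 := by
    rw [hQ, hcomp, Polynomial.coeff_map]
    intro h
    exact hi (aeval_linear_injective G hdet (by rw [map_zero]; exact h))
  have hhom : (MvPolynomial.aeval σ F).IsHomogeneous (1 * r) := by
    refine (homPoly_isHomogeneous f).aeval _ fun k => ?_
    refine MvPolynomial.IsHomogeneous.add ?_ (MvPolynomial.IsHomogeneous.sum _ _ _ fun j _ => ?_)
    · simpa using (MvPolynomial.isHomogeneous_C (Fin (d + 1)) _).mul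
        (MvPolynomial.isHomogeneous_X ℚ (0 : Fin (d + 1)))
    · simpa using (MvPolynomial.isHomogeneous_C (Fin (d + 1)) _).mul
        (MvPolynomial.isHomogeneous_X ℚ j.succ)
  have hdeg : ∀ j, MvPolynomial.degreeOf j Q ≤ r := fun j =>
    (MvPolynomial.degreeOf_coeff_finSuccEquiv _ j i).trans
      ((MvPolynomial.degreeOf_le_totalDegree _ _).trans (by simpa using hhom.totalDegree_le))
  by_contra! hzero
  refine hQ0 (MvPolynomial.eq_zero_of_eval_zero_at_prod_finset Q
    (fun _ => Finset.univ.image fun x : Fin (r + 1) => (x : ℚ)) ?_ ?_)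
  · intro j
    rw [Finset.card_image_of_injective _ (fun x y h => by
      apply Fin.ext; exact_mod_cast h), Finset.card_univ, Fintype.card_fin]
    exact Nat.lt_succ_of_le (hdeg j)
  · intro x hx
    have hx' : ∀ j, ∃ s : Fin (r + 1), (s : ℚ) = x j := fun j => by
      simpa using hx j
    choose s hs using hx'
    rw [← hzero s]
    have hev : Polynomial.map (MvPolynomial.eval x)
        (MvPolynomial.finSuccEquiv ℚ d (MvPolynomial.aeval σ F)) = MvPolynomial.aeval (fun k =>
          Polynomial.C (∑ j, (s j : ℚ) * g j k) +
          Polynomial.C ((Pi.single 0 1 : Fin (d + 1) → ℚ) k) * Polynomial.X) F := by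
      have : ((Polynomial.mapAlgHom (MvPolynomial.aeval x)).comp
          ((MvPolynomial.finSuccEquiv ℚ d).toAlgHom.comp (MvPolynomial.aeval σ))) =
          MvPolynomial.aeval (fun k => Polynomial.C (∑ j, (s j : ℚ) * g j k) +
          Polynomial.C ((Pi.single 0 1 : Fin (d + 1) → ℚ) k) * Polynomial.X) := by
        apply MvPolynomial.algHom_ext
        intro k
        simp [σ, hs, finSuccEquiv_C, MvPolynomial.finSuccEquiv_X_zero,
          MvPolynomial.finSuccEquiv_X_succ, Polynomial.map_sum]
        rw [add_comm]
        simp only [mul_comm]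
      exact DFunLike.congr_fun this F
    rw [hQ, ← Polynomial.coeff_map, hev, aeval_homPoly, Polynomial.finsetSum_coeff]
    refine Finset.sum_congr rfl fun a _ => ?_
    rw [jet, Polynomial.algebraMap_apply, Algebra.algebraMap_self, RingHom.id_apply,
      Polynomial.coeff_C_mul]

/-- If, for each factor, the families of functionals `ℓ h t i` with `i < l` eventually detect the
nonzero elements of every `l`-generated space, then their products detect every fixed nonzero
tensor, with orders bounded by the sizes of the later factors. -/
theorem eventually_exists_sum_mul_prod_ne_zero {τ : Type*} (U : Filter τ) {m : ℕ} :
    ∀ (S : Fin m → Type) [∀ h, Fintype (S h)] (Γ : Fin m → Type)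
      (ℓ : ∀ h, τ → ℕ → Γ h → S h → ℚ),
      (∀ h (l : ℕ) (w : Fin l → S h → ℚ), ∀ᶠ t in U, ∀ f ∈ Submodule.span ℚ (Set.range w),
        f ≠ 0 → ∃ i < l, ∃ j, ∑ a, f a * ℓ h t i j a ≠ 0) →
      ∀ c : (∀ h, S h) → ℚ, c ≠ 0 → ∀ᶠ t in U, ∃ (I : Fin m → ℕ) (j : ∀ h, Γ h),
        (∀ h, I h < ∏ h' ∈ Finset.Ioi h, Fintype.card (S h')) ∧
        ∑ J, c J * ∏ h, ℓ h t (I h) (j h) (J h) ≠ 0 := by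
  induction m with
  | zero =>
    intro S _ Γ ℓ _ c hc
    refine Filter.Eventually.of_forall fun t =>
      ⟨fun h => h.elim0, fun h => h.elim0, fun h => h.elim0, ?_⟩
    obtain ⟨J, hJ⟩ := Function.ne_iff.1 hc
    rw [Fintype.sum_subsingleton _ J]
    simpa using hJ
  | succ m ih =>
    intro S _ Γ ℓ nd c hc
    obtain ⟨J, hJ⟩ := Function.ne_iff.1 hc
    have hc' : (fun J' : ∀ h : Fin m, S h.succ => c (Fin.cons (J 0) J')) ≠ 0 := by
      refine Function.ne_iff.2 ⟨Fin.tail J, ?_⟩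
      simpa [Fin.cons_self_tail] using hJ
    have h1 := ih (fun h => S h.succ) (fun h => Γ h.succ) (fun h => ℓ h.succ)
      (fun h => nd h.succ) _ hc'
    let e := Fintype.equivFin (∀ h : Fin m, S h.succ)
    have h2 := nd 0 _ (fun i a => c (Fin.cons a (e.symm i)))
    filter_upwards [h1, h2] with t ht1 ht2
    obtain ⟨I, j, hI, hne⟩ := ht1
    let f : S 0 → ℚ := ∑ J' : ∀ h : Fin m, S h.succ,
      (∏ h, ℓ h.succ t (I h) (j h) (J' h)) • fun a => c (Fin.cons a J')
    have hf : ∀ a, f a = ∑ J' : ∀ h : Fin m, S h.succ,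
        c (Fin.cons a J') * ∏ h, ℓ h.succ t (I h) (j h) (J' h) := by
      intro a
      simp [f, Finset.sum_apply, mul_comm]
    obtain ⟨i, hi, j0, hij⟩ := ht2 f
      (Submodule.sum_mem _ fun J' _ => Submodule.smul_mem _ _
        (Submodule.subset_span ⟨e J', by simp⟩))
      (fun h => hne (by rw [← hf, h, Pi.zero_apply]))
    refine ⟨Fin.cons i I, Fin.cons j0 j, ?_, ?_⟩
    · intro h
      refine Fin.cases ?_ (fun h => ?_) h
      · rw [Fin.prod_Ioi_zero]
        simpa [Fintype.card_pi] using hi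
      · rw [Fin.prod_Ioi_succ]
        simpa using hI h
    · convert hij using 1
      rw [← (Fin.consEquiv S).sum_comp, Fintype.sum_prod_type]
      refine Finset.sum_congr rfl fun a _ => ?_
      rw [hf, Finset.sum_mul]
      refine Finset.sum_congr rfl fun J' _ => ?_
      simp [Fin.consEquiv, Fin.prod_univ_succ]
      ring

/-- An infinite set of exponents contains sequences whose growth, compared with a given function
of the later terms, is arbitrarily fast. -/
theorem exists_rapidly_decreasing {E : Set ℕ} (hE : E.Infinite) {k : ℕ} (hk : 2 ≤ k)
    (N : ℕ → ℕ) {δ : ℝ} (hδ : 0 < δ) (m : ℕ) :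
    ∃ e : Fin m → ℕ, ∀ h, e h ∈ E ∧
      ((∏ h' ∈ Finset.Ioi h, N (e h') : ℕ) : ℝ) ≤ δ * (k : ℝ) ^ e h := by
  induction m with
  | zero => exact ⟨fun h => h.elim0, fun h => h.elim0⟩
  | succ m ih =>
    obtain ⟨e, he⟩ := ih
    have hk' : (1 : ℝ) < k := by exact_mod_cast hk
    have h1 : ∀ᶠ n : ℕ in Filter.atTop, ((∏ h, N (e h) : ℕ) : ℝ) ≤ δ * (k : ℝ) ^ n :=
      ((tendsto_pow_atTop_atTop_of_one_lt hk').const_mul_atTop hδ).eventually_ge_atTop _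
    obtain ⟨n, hn⟩ := Filter.eventually_atTop.1 h1
    obtain ⟨n', hn'E, hn'⟩ := hE.exists_gt n
    refine ⟨Fin.cons n' e, fun h => ?_⟩
    refine Fin.cases ?_ (fun h => ?_) h
    · rw [Fin.prod_Ioi_zero]
      simpa [hn'E] using hn n' hn'.le
    · rw [Fin.prod_Ioi_succ]
      simpa using he h

/-- A large deviation bound for sums of independent centred bounded functions. -/
theorem card_filter_lt_sum_le {m : ℕ} (S : Fin m → Type) [∀ h, Fintype (S h)]
    (w : ∀ h, S h → ℝ) (hw : ∀ h a, |w h a| ≤ 1) (hsum : ∀ h, ∑ a, w h a = 0) {ε : ℝ}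
    (hε : 0 ≤ ε) (hε' : ε ≤ 2) :
    ((Finset.univ.filter fun J : ∀ h, S h => m * ε < ∑ h, w h (J h)).card : ℝ) ≤
      Real.exp (-(m * (ε ^ 2 / 4))) * Fintype.card (∀ h, S h) := by
  have h1 : ((Finset.univ.filter fun J : ∀ h, S h => m * ε < ∑ h, w h (J h)).card : ℝ) ≤
      ∑ J : ∀ h, S h, Real.exp (ε / 2 * (∑ h, w h (J h) - m * ε)) := by
    rw [Finset.card_filter, Nat.cast_sum]
    refine Finset.sum_le_sum fun J _ => ?_
    split_ifs with hJ
    · rw [Nat.cast_one]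
      exact Real.one_le_exp (mul_nonneg (by linarith) (by linarith))
    · simpa using (Real.exp_pos _).le
  have h2 : ∀ h, ∑ a, Real.exp (ε / 2 * w h a) ≤ Fintype.card (S h) * Real.exp ((ε / 2) ^ 2) := by
    intro h
    have h3 : ∀ a, Real.exp (ε / 2 * w h a) ≤ 1 + ε / 2 * w h a + (ε / 2) ^ 2 := by
      intro a
      have ha : |ε / 2 * w h a| ≤ ε / 2 := by
        rw [abs_mul, abs_of_nonneg (by linarith : 0 ≤ ε / 2)]
        exact mul_le_of_le_one_right (by linarith) (hw h a)
      have h4 := Real.abs_exp_sub_one_sub_id_le (ha.trans (by linarith))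
      have h5 : (ε / 2 * w h a) ^ 2 ≤ (ε / 2) ^ 2 := sq_le_sq.2 (ha.trans (le_abs_self _))
      linarith [le_abs_self (Real.exp (ε / 2 * w h a) - 1 - ε / 2 * w h a)]
    calc ∑ a, Real.exp (ε / 2 * w h a) ≤ ∑ a, (1 + ε / 2 * w h a + (ε / 2) ^ 2) :=
          Finset.sum_le_sum fun a _ => h3 a
      _ = Fintype.card (S h) * (1 + (ε / 2) ^ 2) := by
          rw [Finset.sum_add_distrib, Finset.sum_add_distrib, ← Finset.mul_sum, hsum]
          simp
          ring
      _ ≤ _ := by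
          gcongr
          linarith [Real.add_one_le_exp ((ε / 2) ^ 2)]
  refine h1.trans ?_
  calc ∑ J : ∀ h, S h, Real.exp (ε / 2 * (∑ h, w h (J h) - m * ε))
      = Real.exp (-(m * (ε ^ 2 / 2))) * ∏ h, ∑ a, Real.exp (ε / 2 * w h a) := by
        rw [Finset.prod_univ_sum, Fintype.piFinset_univ, Finset.mul_sum]
        refine Finset.sum_congr rfl fun J _ => ?_
        rw [← Real.exp_sum, ← Real.exp_add, ← Finset.mul_sum]
        congr 1
        ring
    _ ≤ Real.exp (-(m * (ε ^ 2 / 2))) * ∏ h, (Fintype.card (S h) * Real.exp ((ε / 2) ^ 2)) := by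
        gcongr with h _
        exact h2 h
    _ = _ := by
        rw [Finset.prod_mul_distrib, Finset.prod_const, Finset.card_univ, Fintype.card_fin,
          ← Real.exp_nat_mul, mul_left_comm, ← Real.exp_add, Fintype.card_pi, Nat.cast_prod,
          mul_comm]
        congr 2
        ring

/-- Siegel-type construction: an integral tensor vanishing at all indices of large `u`-weight and,
after a linear change of coordinates over a number field, of large `v`-weight. -/
theorem exists_ne_zero_tensor (K : Type*) [Field K] [Algebra ℚ K] [FiniteDimensional ℚ K]
    {ε L : ℝ} (hε : 0 < ε) (hL : ε ≤ L) :
    ∃ m : ℕ, 0 < m ∧ ∀ (S : Fin m → Type) [∀ h, Fintype (S h)] [∀ h, Nonempty (S h)]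
      (u v : ∀ h, S h → ℝ), (∀ h a, |u h a| ≤ L) → (∀ h a, |v h a| ≤ L) →
      (∀ h, ∑ a, u h a = 0) → (∀ h, ∑ a, v h a = 0) → ∀ A : ∀ h, S h → S h → K,
      ∃ c : (∀ h, S h) → ℤ, c ≠ 0 ∧ (∀ J, m * ε < ∑ h, u h (J h) → c J = 0) ∧
        ∀ J' : ∀ h, S h, m * ε < ∑ h, v h (J' h) → ∑ J, (c J : K) * ∏ h, A h (J h) (J' h) = 0 := by
  have : CharZero K := algebraRat.charZero K
  have hL0 : 0 < L := hε.trans_le hL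
  have hη : 0 < (ε / L) ^ 2 / 4 := by positivity
  set D := Module.finrank ℚ K with hD
  obtain ⟨m, hm0, hm⟩ : ∃ m : ℕ, 0 < m ∧
      (1 + D : ℝ) * Real.exp (-(m * ((ε / L) ^ 2 / 4))) < 1 := by
    have h1 : Filter.Tendsto (fun m : ℕ => (1 + D : ℝ) * Real.exp (-(m * ((ε / L) ^ 2 / 4))))
        Filter.atTop (nhds ((1 + D : ℝ) * 0)) := by
      refine Filter.Tendsto.const_mul _ (Real.tendsto_exp_neg_atTop_nhds_zero.comp ?_)
      exact tendsto_natCast_atTop_atTop.atTop_mul_const hη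
    rw [mul_zero] at h1
    exact ((Filter.eventually_gt_atTop 0).and (h1.eventually_lt_const one_pos)).exists
  refine ⟨m, hm0, ?_⟩
  intro S _ _ u v hu hv hu0 hv0 A
  have key : ∀ w : ∀ h, S h → ℝ, (∀ h a, |w h a| ≤ L) → (∀ h, ∑ a, w h a = 0) →
      (Fintype.card {J : ∀ h, S h // m * ε < ∑ h, w h (J h)} : ℝ) ≤
        Real.exp (-(m * ((ε / L) ^ 2 / 4))) * Fintype.card (∀ h, S h) := by
    intro w hw hw0
    have h1 := card_filter_lt_sum_le S (fun h a => w h a / L)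
      (fun h a => by rw [abs_div, abs_of_pos hL0, div_le_one hL0]; exact hw h a)
      (fun h => by rw [← Finset.sum_div, hw0, zero_div]) (ε := ε / L) (by positivity)
      (((div_le_one hL0).2 hL).trans one_le_two)
    rw [Fintype.card_subtype]
    simpa only [← Finset.sum_div, ← mul_div_assoc, div_lt_div_iff_of_pos_right hL0] using h1
  let φ : ((∀ h, S h) → ℚ) →ₗ[ℚ] ({J : ∀ h, S h // m * ε < ∑ h, u h (J h)} → ℚ) ×
      ({J : ∀ h, S h // m * ε < ∑ h, v h (J h)} → K) :=
    { toFun := fun c => (fun J => c J.1, fun J' => ∑ J, algebraMap ℚ K (c J) * ∏ h, A h (J h) (J'.1 h))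
      map_add' := by
        intro x y
        ext <;> simp [add_mul, Finset.sum_add_distrib]
      map_smul' := by
        intro q x
        refine Prod.ext (funext fun J => rfl) (funext fun J' => ?_)
        simp [Algebra.smul_def, Finset.mul_sum, mul_assoc] }
  have hcard : 0 < Fintype.card (∀ h, S h) := Fintype.card_pos
  have hrank : Module.finrank ℚ (({J : ∀ h, S h // m * ε < ∑ h, u h (J h)} → ℚ) ×
      ({J : ∀ h, S h // m * ε < ∑ h, v h (J h)} → K)) < Module.finrank ℚ ((∀ h, S h) → ℚ) := by
    rw [Module.finrank_prod, Module.finrank_fintype_fun_eq_card,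
      Module.finrank_fintype_fun_eq_card, Module.finrank_pi_fintype, Finset.sum_const,
      Finset.card_univ, ← hD, smul_eq_mul]
    have h1 := key u hu hu0
    have h2 := key v hv hv0
    have h3 : (0 : ℝ) < Fintype.card (∀ h, S h) := by exact_mod_cast hcard
    rw [← Nat.cast_lt (α := ℝ)]
    push_cast
    have h4 : (0 : ℝ) ≤ D := Nat.cast_nonneg _
    nlinarith [mul_lt_mul_of_pos_right hm h3, mul_le_mul_of_nonneg_right h2 h4]
  obtain ⟨c, hc, hc0⟩ := (Submodule.ne_bot_iff _).1 (LinearMap.ker_ne_bot_of_finrank_lt (f := φ) hrank)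
  have hc' : φ c = 0 := hc
  obtain ⟨q, hq⟩ := IsLocalization.exist_integer_multiples_of_finite (nonZeroDivisors ℤ) c
  choose z hz using hq
  have hq0 : (q : ℤ) ≠ 0 := nonZeroDivisors.coe_ne_zero q
  have hz' : ∀ J, (z J : ℚ) = (q : ℤ) * c J := fun J => by
    have := hz J
    simpa [Algebra.smul_def] using this
  refine ⟨z, ?_, ?_, ?_⟩
  · obtain ⟨J, hJ⟩ := Function.ne_iff.1 hc0
    refine Function.ne_iff.2 ⟨J, fun h => ?_⟩
    have := hz' J
    rw [h] at this
    have h5 : ((q : ℤ) : ℚ) * c J ≠ 0 := mul_ne_zero (by exact_mod_cast hq0) hJ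
    exact h5 (by simpa using this.symm)
  · intro J hJ
    have h5 : c J = 0 := congrFun (congrArg Prod.fst hc') ⟨J, hJ⟩
    have := hz' J
    rw [h5, mul_zero] at this
    exact_mod_cast this
  · intro J' hJ'
    have h5 : ∑ J, algebraMap ℚ K (c J) * ∏ h, A h (J h) (J' h) = 0 :=
      congrFun (congrArg Prod.snd hc') ⟨J', hJ'⟩
    have h6 : ∀ J, (z J : K) = ((q : ℤ) : K) * algebraMap ℚ K (c J) := fun J => by
      have := congrArg (algebraMap ℚ K) (hz' J)
      simpa [map_mul] using this
    simp_rw [h6, mul_assoc, ← Finset.mul_sum]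
    rw [h5, mul_zero]

instance HomExp.instNonempty (d r : ℕ) : Nonempty (HomExp (d + 1) r) :=
  ⟨⟨Pi.single 0 r, by simp [Finset.mem_piAntidiag]⟩⟩

/-- Each variable has the same average exponent over the monomials of a given degree. -/
theorem HomExp.card_mul_sum_apply (N r : ℕ) (k : Fin N) :
    N * ∑ a : HomExp N r, a.1 k = r * Fintype.card (HomExp N r) := by
  have hswap : ∀ l, ∑ a : HomExp N r, a.1 l = ∑ a : HomExp N r, a.1 k := by
    intro l
    have hmem : ∀ a : HomExp N r, a.1 ∘ Equiv.swap k l ∈ Finset.piAntidiag Finset.univ r := by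
      intro a
      rw [Finset.mem_piAntidiag]
      refine ⟨?_, by simp⟩
      exact (Equiv.sum_comp (Equiv.swap k l) a.1).trans a.sum_eq
    let σ : HomExp N r → HomExp N r := fun a => ⟨a.1 ∘ Equiv.swap k l, hmem a⟩
    have hσ : Function.Involutive σ := by
      intro a
      apply Subtype.ext
      funext i
      simp [σ]
    refine Fintype.sum_equiv hσ.toPerm _ _ fun a => ?_
    simp [σ]
  calc N * ∑ a : HomExp N r, a.1 k = ∑ l : Fin N, ∑ a : HomExp N r, a.1 l := by
        rw [Finset.sum_congr rfl fun l _ => hswap l]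
        simp
    _ = ∑ a : HomExp N r, ∑ l, a.1 l := Finset.sum_comm
    _ = _ := by simp [HomExp.sum_eq, mul_comm]

/-- The deviation from its mean of the normalised weight of a monomial. -/
noncomputable def HomExp.dev {N r : ℕ} (e : Fin N → ℝ) (a : HomExp N r) : ℝ :=
  (∑ k, e k * a.1 k) / r - (∑ k, e k) / N

theorem HomExp.sum_dev {N r : ℕ} (hN : N ≠ 0) (hr : r ≠ 0) (e : Fin N → ℝ) :
    ∑ a : HomExp N r, a.dev e = 0 := by
  have hN' : (N : ℝ) ≠ 0 := by exact_mod_cast hN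
  have hr' : (r : ℝ) ≠ 0 := by exact_mod_cast hr
  simp only [HomExp.dev, Finset.sum_sub_distrib, ← Finset.sum_div]
  rw [Finset.sum_comm]
  simp only [← Finset.mul_sum]
  have h1 : ∀ k, ∑ a : HomExp N r, (a.1 k : ℝ) = r * Fintype.card (HomExp N r) / N := by
    intro k
    rw [eq_div_iff hN', mul_comm]
    exact_mod_cast HomExp.card_mul_sum_apply N r k
  simp only [h1, ← Finset.sum_mul, Finset.sum_const, Finset.card_univ, nsmul_eq_mul]
  field_simp
  simp

theorem HomExp.abs_dev_le {N r : ℕ} (hN : N ≠ 0) (hr : r ≠ 0) {e : Fin N → ℝ} {L : ℝ}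
    (hL : ∀ k, |e k| ≤ L) (a : HomExp N r) : |a.dev e| ≤ 2 * L := by
  have hN' : (0 : ℝ) < N := by exact_mod_cast Nat.pos_of_ne_zero hN
  have hr' : (0 : ℝ) < r := by exact_mod_cast Nat.pos_of_ne_zero hr
  have h1 : |∑ k, e k * a.1 k| ≤ L * r := by
    calc |∑ k, e k * a.1 k| ≤ ∑ k, |e k * a.1 k| := Finset.abs_sum_le_sum_abs _ _
      _ ≤ ∑ k, L * a.1 k := by
          refine Finset.sum_le_sum fun k _ => ?_
          rw [abs_mul, Nat.abs_cast]
          exact mul_le_mul_of_nonneg_right (hL k) (Nat.cast_nonneg _)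
      _ = L * r := by
          rw [← Finset.mul_sum]
          congr 1
          exact_mod_cast a.sum_eq
  have h2 : |∑ k, e k| ≤ L * N := by
    calc |∑ k, e k| ≤ ∑ k, |e k| := Finset.abs_sum_le_sum_abs _ _
      _ ≤ ∑ k : Fin N, L := Finset.sum_le_sum fun k _ => hL k
      _ = L * N := by simp [mul_comm]
  refine (abs_sub _ _).trans ?_
  rw [abs_div, abs_div, Nat.abs_cast, Nat.abs_cast, two_mul]
  exact add_le_add ((div_le_iff₀ hr').2 h1) ((div_le_iff₀ hN').2 h2)

theorem map_jet {R R' : Type*} [CommSemiring R] [CommSemiring R'] (φ : R →+* R') {N : ℕ}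
    (u v : Fin N → R) (a : Fin N → ℕ) :
    (jet u v a).map φ = jet (fun k => φ (u k)) (fun k => φ (v k)) a := by
  simp [jet, Polynomial.map_prod]

theorem jet_mul {R : Type*} [CommSemiring R] {N : ℕ} (y u v : Fin N → R) (a : Fin N → ℕ) :
    jet (fun k => u k * y k) (fun k => v k * y k) a =
      jet u v a * Polynomial.C (∏ k, y k ^ a k) := by
  simp only [jet, map_prod, ← Finset.prod_mul_distrib, map_pow, ← mul_pow, map_mul]
  exact Finset.prod_congr rfl fun k _ => by ring

theorem exists_int_jet_coeff_mul {N : ℕ} {u v y : Fin N → ℚ}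
    (hu : ∀ k, ∃ z : ℤ, u k * y k = z) (hv : ∀ k, ∃ z : ℤ, v k * y k = z) (a : Fin N → ℕ)
    (i : ℕ) : ∃ z : ℤ, (jet u v a).coeff i * ∏ k, y k ^ a k = z := by
  choose u' hu' using hu
  choose v' hv' using hv
  refine ⟨(jet u' v' a).coeff i, ?_⟩
  rw [← Polynomial.coeff_mul_C, ← jet_mul]
  simp only [hu', hv']
  rw [← eq_intCast (Int.castRingHom ℚ), ← Polynomial.coeff_map, map_jet]
  rfl

theorem abs_jet_coeff_mul_pow_le {N : ℕ} (u v : Fin N → ℝ) (a : Fin N → ℕ) (i : ℕ) {ρ : ℝ}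
    (hρ : 0 ≤ ρ) : |(jet u v a).coeff i| * ρ ^ i ≤ ∏ k, (|v k| + |u k| * ρ) ^ a k := by
  have hmul : ∀ p q p' q' : Polynomial ℝ, (∀ i, |p.coeff i| ≤ q.coeff i) →
      (∀ i, |p'.coeff i| ≤ q'.coeff i) → ∀ i, |(p * p').coeff i| ≤ (q * q').coeff i := by
    intro p q p' q' h h' i
    rw [Polynomial.coeff_mul, Polynomial.coeff_mul]
    refine (Finset.abs_sum_le_sum_abs _ _).trans (Finset.sum_le_sum fun x _ => ?_)
    rw [abs_mul]
    exact mul_le_mul (h _) (h' _) (abs_nonneg _) ((abs_nonneg _).trans (h _))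
  have hone : ∀ i, |(1 : Polynomial ℝ).coeff i| ≤ (1 : Polynomial ℝ).coeff i := by
    intro i
    rw [Polynomial.coeff_one]
    split_ifs <;> simp
  have hpow : ∀ (p q : Polynomial ℝ) (n : ℕ), (∀ i, |p.coeff i| ≤ q.coeff i) →
      ∀ i, |(p ^ n).coeff i| ≤ (q ^ n).coeff i := by
    intro p q n h
    induction n with
    | zero => simpa using hone
    | succ n ih =>
      rw [pow_succ, pow_succ]
      exact hmul _ _ _ _ ih h
  have hlin : ∀ k i, |(Polynomial.C (v k) + Polynomial.C (u k) * Polynomial.X).coeff i| ≤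
      (Polynomial.C |v k| + Polynomial.C |u k| * Polynomial.X).coeff i := by
    intro k i
    rcases i with _ | _ | i <;> simp [Polynomial.coeff_C, Polynomial.coeff_X]
  have hprod : ∀ (s : Finset (Fin N)) (i : ℕ),
      |(∏ k ∈ s, (Polynomial.C (v k) + Polynomial.C (u k) * Polynomial.X) ^ a k).coeff i| ≤
      (∏ k ∈ s, (Polynomial.C |v k| + Polynomial.C |u k| * Polynomial.X) ^ a k).coeff i := by
    intro s
    induction s using Finset.induction_on with
    | empty => simpa using hone
    | insert k s hk ih =>
      rw [Finset.prod_insert hk, Finset.prod_insert hk]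
      exact hmul _ _ _ _ (hpow _ _ _ (hlin k)) ih
  set q := ∏ k, (Polynomial.C |v k| + Polynomial.C |u k| * Polynomial.X) ^ a k with hq
  have hqc : ∀ i, |(jet u v a).coeff i| ≤ q.coeff i := hprod Finset.univ
  have hq0 : ∀ i, 0 ≤ q.coeff i := fun i => (abs_nonneg _).trans (hqc i)
  have heval : q.eval ρ = ∏ k, (|v k| + |u k| * ρ) ^ a k := by
    simp [hq, Polynomial.eval_prod]
  rw [← heval]
  refine (mul_le_mul_of_nonneg_right (hqc i) (by positivity)).trans ?_
  by_cases hi : i ≤ q.natDegree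
  · rw [Polynomial.eval_eq_sum_range]
    exact Finset.single_le_sum (f := fun i => q.coeff i * ρ ^ i)
      (fun i _ => mul_nonneg (hq0 i) (by positivity)) (Finset.mem_range_succ_iff.2 hi)
  · rw [Polynomial.coeff_eq_zero_of_natDegree_lt (not_le.1 hi), zero_mul,
      Polynomial.eval_eq_sum_range]
    exact Finset.sum_nonneg fun i _ => mul_nonneg (hq0 i) (by positivity)

/-- Monomials in linear forms are combinations, with coefficients independent of the point, of
monomials in the variables. -/
theorem exists_jet_eq_sum {K R : Type*} [CommRing K] [CommRing R] [Algebra K R] {N : ℕ} (r : ℕ)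
    (B : Fin N → Fin N → K) : ∃ A : HomExp N r → HomExp N r → K, ∀ (u v : Fin N → R) a,
      jet (fun k => ∑ l, algebraMap K R (B k l) * u l)
        (fun k => ∑ l, algebraMap K R (B k l) * v l) a.1 =
      ∑ a', Polynomial.C (algebraMap K R (A a a')) * jet u v a'.1 := by
  let P : HomExp N r → MvPolynomial (Fin N) K := fun a =>
    ∏ k, (∑ l, MvPolynomial.C (B k l) * MvPolynomial.X l) ^ a.1 k
  have hP : ∀ a, (P a).IsHomogeneous r := by
    intro a
    have h1 : (P a).IsHomogeneous (∑ k, 1 * a.1 k) :=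
      MvPolynomial.IsHomogeneous.prod _ _ _ fun k _ =>
        (MvPolynomial.IsHomogeneous.sum _ _ _ fun l _ => by
          simpa using (MvPolynomial.isHomogeneous_C (Fin N) (B k l)).mul
            (MvPolynomial.isHomogeneous_X K l)).pow _
    simpa [a.sum_eq] using h1
  refine ⟨fun a a' => (P a).coeff (Finsupp.equivFunOnFinite.symm a'.1), fun u v a => ?_⟩
  let y : Fin N → Polynomial R := fun l => Polynomial.C (v l) + Polynomial.C (u l) * Polynomial.X
  have h1 : MvPolynomial.aeval y (P a) = jet (fun k => ∑ l, algebraMap K R (B k l) * u l)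
        (fun k => ∑ l, algebraMap K R (B k l) * v l) a.1 := by
    simp only [P, jet, map_prod, map_pow, map_sum, map_mul, MvPolynomial.aeval_X,
      MvPolynomial.algHom_C, Polynomial.algebraMap_apply, y]
    refine Finset.prod_congr rfl fun k _ => ?_
    congr 1
    rw [Finset.sum_mul, ← Finset.sum_add_distrib]
    exact Finset.sum_congr rfl fun l _ => by ring
  rw [← h1, MvPolynomial.aeval_def, MvPolynomial.eval₂_eq']
  rw [Finset.sum_coe_sort (Finset.piAntidiag Finset.univ r) fun a' : Fin N → ℕ =>
    Polynomial.C (algebraMap K R ((P a).coeff (Finsupp.equivFunOnFinite.symm a'))) * jet u v a']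
  refine Finset.sum_of_injOn (fun s => s) (fun s _ s' _ h => DFunLike.coe_injective h) ?_ ?_ ?_
  · intro s hs
    have h2 := hP a (MvPolynomial.mem_support_iff.1 hs)
    rw [Finsupp.weight_apply, Finsupp.sum_fintype _ _ (by simp)] at h2
    simpa [Finset.mem_piAntidiag] using h2
  · intro s _ hs
    have : (P a).coeff (Finsupp.equivFunOnFinite.symm s) = 0 := by
      by_contra h
      exact hs ⟨Finsupp.equivFunOnFinite.symm s, MvPolynomial.mem_support_iff.2 h, by simp⟩
    rw [this]
    simp
  · intro s _
    simp [jet, y, Polynomial.algebraMap_apply]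

theorem abs_jet_coeff_le {N r : ℕ} {u v f : Fin N → ℝ} {x F c₁ c₂ : ℝ} (hx : 1 ≤ x)
    (hc₁ : 0 ≤ c₁) (hc₂ : 0 ≤ c₂) (hv : ∀ l, |v l| ≤ c₁ * x ^ f l) (hu : ∀ l, |u l| ≤ c₂)
    (hF : ∀ l, -F ≤ f l) (a : HomExp N r) (i : ℕ) :
    |(jet u v a.1).coeff i| ≤ (c₁ + c₂) ^ r * x ^ (∑ l, f l * a.1 l + F * i) := by
  have hx0 : 0 < x := one_pos.trans_le hx
  have h1 := abs_jet_coeff_mul_pow_le u v a.1 i (Real.rpow_nonneg hx0.le (-F))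
  have h2 : ∏ l, (|v l| + |u l| * x ^ (-F)) ^ a.1 l ≤ (c₁ + c₂) ^ r * x ^ (∑ l, f l * a.1 l) := by
    have h3 : (c₁ + c₂) ^ r * x ^ (∑ l, f l * a.1 l) = ∏ l, ((c₁ + c₂) * x ^ f l) ^ a.1 l := by
      rw [Real.rpow_sum_of_pos hx0]
      simp only [mul_pow, Finset.prod_mul_distrib, Finset.prod_pow_eq_pow_sum, a.sum_eq,
        Real.rpow_mul_natCast hx0.le]
    rw [h3]
    refine Finset.prod_le_prod (fun l _ => by positivity) fun l _ => ?_
    refine pow_le_pow_left₀ (by positivity) ?_ _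
    rw [add_mul]
    exact add_le_add (hv l)
      (mul_le_mul (hu l) (Real.rpow_le_rpow_of_exponent_le hx (hF l)) (by positivity) hc₂)
  have h4 : x ^ (F * i) * (x ^ (-F)) ^ i = 1 := by
    rw [← Real.rpow_mul_natCast hx0.le, ← Real.rpow_add hx0]
    simp
  calc |(jet u v a.1).coeff i|
      = |(jet u v a.1).coeff i| * (x ^ (-F)) ^ i * x ^ (F * i) := by
        rw [mul_assoc, mul_comm ((x ^ (-F)) ^ i), h4, mul_one]
    _ ≤ (c₁ + c₂) ^ r * x ^ (∑ l, f l * a.1 l) * x ^ (F * i) :=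
        mul_le_mul_of_nonneg_right (h1.trans h2) (by positivity)
    _ = _ := by rw [mul_assoc, ← Real.rpow_add hx0]

/-- A nonzero value of an integral tensor is bounded below in terms of its denominator. -/
theorem one_le_abs_sum_mul_prod_mul_rpow {m N k b t : ℕ} (hk : 0 < k) (hb : 1 ≤ b)
    {q : Fin m → ℕ} (hq : ∀ h, q h ≤ t) (c : (∀ h, HomExp N (k ^ q h)) → ℤ)
    (ℓ : ∀ h, HomExp N (k ^ q h) → ℚ) (e : Fin N → ℕ)
    (hint : ∀ h a, ∃ z : ℤ, ℓ h a * ∏ j, ((b : ℚ) ^ (k ^ (t - q h) * e j)) ^ a.1 j = z)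
    {θ : ℝ} (hθ : 0 ≤ θ)
    (hc : ∀ J, c J ≠ 0 → ∑ h, (∑ j, (e j : ℝ) * (J h).1 j) / ((k ^ q h : ℕ) : ℝ) ≤ θ)
    (hV : ∑ J, c J * ∏ h, ℓ h (J h) ≠ 0) :
    1 ≤ |((∑ J, c J * ∏ h, ℓ h (J h) : ℚ) : ℝ)| * (b : ℝ) ^ ((k : ℝ) ^ t * θ) := by
  have hk0 : (0 : ℝ) < k := by exact_mod_cast hk
  set V := ∑ J, c J * ∏ h, ℓ h (J h) with hVdef
  set Q := ⌊(k : ℝ) ^ t * θ⌋₊ with hQ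
  have hmem : V * (b : ℚ) ^ Q ∈ (Int.castRingHom ℚ).range := by
    rw [hVdef, Finset.sum_mul]
    refine Subring.sum_mem _ fun J _ => ?_
    by_cases hJ : c J = 0
    · simp [hJ]
    have hle : ∑ h, ∑ j, k ^ (t - q h) * e j * (J h).1 j ≤ Q := by
      rw [hQ]
      refine Nat.le_floor ?_
      refine le_trans (le_of_eq ?_) (mul_le_mul_of_nonneg_left (hc J hJ) (by positivity))
      push_cast
      rw [Finset.mul_sum]
      refine Finset.sum_congr rfl fun h _ => ?_
      rw [← Nat.sub_add_cancel (hq h), pow_add, Nat.sub_add_cancel (hq h), mul_div_assoc',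
        mul_right_comm, mul_div_assoc, div_self (by positivity), mul_one, Finset.mul_sum]
      exact Finset.sum_congr rfl fun j _ => by ring
    obtain ⟨p, hp⟩ := Nat.exists_eq_add_of_le hle
    have h1 : (c J : ℚ) * (∏ h, ℓ h (J h)) * (b : ℚ) ^ Q =
        c J * ((∏ h, (ℓ h (J h) * ∏ j, ((b : ℚ) ^ (k ^ (t - q h) * e j)) ^ (J h).1 j)) *
          (b : ℚ) ^ p) := by
      rw [hp, pow_add, Finset.prod_mul_distrib, ← Finset.prod_pow_eq_pow_sum]
      simp only [← pow_mul, Finset.prod_pow_eq_pow_sum]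
      ring
    have h2 : (b : ℚ) ∈ (Int.castRingHom ℚ).range := ⟨b, by simp⟩
    rw [h1]
    refine Subring.mul_mem _ ⟨c J, by simp⟩ (Subring.mul_mem _
      (Subring.prod_mem _ fun h _ => ?_) (Subring.pow_mem _ h2 _))
    obtain ⟨z, hz⟩ := hint h (J h)
    exact ⟨z, by simp [hz]⟩
  obtain ⟨z, hz⟩ := hmem
  have hb0 : (0 : ℝ) < b := by exact_mod_cast hb
  have hz' : (z : ℚ) = V * (b : ℚ) ^ Q := by simpa using hz
  have hz0 : z ≠ 0 := by
    rintro rfl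
    have h2 : (b : ℚ) ^ Q ≠ 0 := pow_ne_zero _ (by exact_mod_cast (Nat.one_le_iff_ne_zero.1 hb))
    simp [h2, hV] at hz'
  have h3 : (1 : ℝ) ≤ |(z : ℝ)| := by
    rw [← Int.cast_abs]
    exact_mod_cast Int.one_le_abs hz0
  have h4 : (z : ℝ) = V * (b : ℝ) ^ Q := by
    have := congrArg (Rat.cast (K := ℝ)) hz'
    simpa using this
  rw [h4, abs_mul, abs_of_nonneg (by positivity : (0 : ℝ) ≤ (b : ℝ) ^ Q)] at h3
  refine h3.trans (mul_le_mul_of_nonneg_left ?_ (abs_nonneg _))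
  rw [← Real.rpow_natCast]
  exact Real.rpow_le_rpow_of_exponent_le (by exact_mod_cast hb)
    (Nat.floor_le (by positivity))

/-- An upper bound for a tensor supported on indices of small weight. -/
theorem abs_sum_mul_prod_le {m N k b t : ℕ} (hk : 0 < k) (hb : 1 ≤ b) {q : Fin m → ℕ}
    (hq : ∀ h, q h ≤ t) (c : (∀ h, HomExp N (k ^ q h)) → ℝ)
    (ℓ : ∀ h, HomExp N (k ^ q h) → ℝ) {f : Fin N → ℝ} {C : Fin m → ℝ} {F δ θ : ℝ}
    (hF : 0 ≤ F) (hC : ∀ h, 0 ≤ C h) {I : Fin m → ℕ}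
    (hI : ∀ h, (I h : ℝ) ≤ δ * (k : ℝ) ^ q h)
    (hℓ : ∀ h a, |ℓ h a| ≤
      C h * ((b : ℝ) ^ ((k : ℝ) ^ (t - q h))) ^ (∑ j, f j * a.1 j + F * I h))
    (hc : ∀ J, c J ≠ 0 → ∑ h, (∑ j, f j * (J h).1 j) / ((k ^ q h : ℕ) : ℝ) ≤ θ) :
    |∑ J, c J * ∏ h, ℓ h (J h)| ≤
      (∑ J, |c J| * ∏ h, C h) * (b : ℝ) ^ ((k : ℝ) ^ t * (θ + m * (F * δ))) := by
  have hk0 : (0 : ℝ) < k := by exact_mod_cast hk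
  have hb1 : (1 : ℝ) ≤ b := by exact_mod_cast hb
  have hb0 : (0 : ℝ) < b := one_pos.trans_le hb1
  rw [Finset.sum_mul]
  refine (Finset.abs_sum_le_sum_abs _ _).trans (Finset.sum_le_sum fun J _ => ?_)
  rw [abs_mul, mul_assoc]
  by_cases hJ : c J = 0
  · simp [hJ]
  refine mul_le_mul_of_nonneg_left ?_ (abs_nonneg _)
  rw [Finset.abs_prod]
  calc ∏ h, |ℓ h (J h)| ≤ ∏ h, (C h * ((b : ℝ) ^ ((k : ℝ) ^ (t - q h))) ^
        (∑ j, f j * (J h).1 j + F * I h)) :=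
        Finset.prod_le_prod (fun h _ => abs_nonneg _) fun h _ => hℓ h _
    _ = (∏ h, C h) * (b : ℝ) ^
        (∑ h, (k : ℝ) ^ (t - q h) * (∑ j, f j * (J h).1 j + F * I h)) := by
        rw [Finset.prod_mul_distrib, Real.rpow_sum_of_pos hb0]
        simp only [Real.rpow_mul hb0.le]
    _ ≤ _ := by
        refine mul_le_mul_of_nonneg_left ?_ (Finset.prod_nonneg fun h _ => hC h)
        refine Real.rpow_le_rpow_of_exponent_le hb1 ?_
        calc ∑ h, (k : ℝ) ^ (t - q h) * (∑ j, f j * (J h).1 j + F * I h)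
            ≤ ∑ h, (k : ℝ) ^ t * ((∑ j, f j * (J h).1 j) / ((k ^ q h : ℕ) : ℝ) + F * δ) := by
              refine Finset.sum_le_sum fun h _ => ?_
              have h1 : (k : ℝ) ^ t = (k : ℝ) ^ (t - q h) * (k : ℝ) ^ q h := by
                rw [← pow_add, Nat.sub_add_cancel (hq h)]
              rw [h1, mul_assoc]
              refine mul_le_mul_of_nonneg_left ?_ (by positivity)
              rw [Nat.cast_pow, mul_add, mul_div_cancel₀ _ (by positivity : (k : ℝ) ^ q h ≠ 0)]
              have := mul_le_mul_of_nonneg_left (hI h) hF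
              linarith
          _ = (k : ℝ) ^ t * (∑ h, (∑ j, f j * (J h).1 j) / ((k ^ q h : ℕ) : ℝ) +
                m * (F * δ)) := by
              rw [← Finset.mul_sum, Finset.sum_add_distrib]
              simp
          _ ≤ _ := by
              have := hc J hJ
              gcongr

/-- There is no sequence of hyperplanes, spanned by rational points with prescribed denominators
and prescribed real approximation properties, that leaves every fixed hyperplane. -/
theorem false_of_approximation_family (K : IntermediateField ℚ ℝ) [FiniteDimensional ℚ K]
    {d k b : ℕ} (hk : 2 ≤ k) (hb : 2 ≤ b) (e : Fin (d + 1) → ℕ) (f : Fin (d + 1) → ℝ)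
    (hef : ∑ j, (e j : ℝ) + ∑ j, f j < 0) (M : Fin (d + 1) → Fin (d + 1) → ℝ)
    (B : Fin (d + 1) → Fin (d + 1) → K)
    (hB : ∀ (y : Fin (d + 1) → ℝ) j, ∑ l, (B j l : ℝ) * ∑ i, M l i * y i = y j)
    (U : Filter ℕ) [U.NeBot] (hU : U ≤ Filter.atTop) {E D : Set ℕ} (hE : E.Infinite)
    (hED : ∀ q ∈ E, ∀ᶠ t in U, t - q ∈ D) (g : ℕ → Fin d → Fin (d + 1) → ℚ)
    (A : ℕ → Fin d → ℚ) {c : ℝ} (hc : 0 ≤ c)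
    (hg : ∀ t ∈ D, ∀ j, g t j 0 = ∑ i, A t i * g t j i.succ)
    (hdet : ∀ t ∈ D, (Matrix.of fun j i : Fin d => g t j i.succ).det ≠ 0)
    (hint : ∀ t ∈ D, ∀ i j, ∃ z : ℤ, g t i j * (b : ℚ) ^ (k ^ t * e j) = z)
    (hf : ∀ t ∈ D, ∀ i l, |∑ j, M l j * (g t i j : ℝ)| ≤ c * ((b : ℝ) ^ ((k : ℝ) ^ t)) ^ f l)
    (hA : ∀ a, ∀ᶠ t in Filter.atTop, t ∈ D → A t ≠ a) : False := by
  have hk1 : (1 : ℝ) < k := by exact_mod_cast hk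
  have hb1 : (1 : ℝ) < b := by exact_mod_cast hb
  have hk0 : 0 < k := by omega
  have hb0' : 1 ≤ b := by omega
  set μe := (∑ j, (e j : ℝ)) / (d + 1 : ℕ) with hμe
  set μf := (∑ j, f j) / (d + 1 : ℕ) with hμf
  obtain ⟨κ, hκ, hκ'⟩ : ∃ κ : ℝ, 0 < κ ∧ μe + μf = -κ := by
    refine ⟨-(μe + μf), ?_, by ring⟩
    rw [hμe, hμf, ← add_div]
    exact neg_pos.2 (div_neg_of_neg_of_pos hef (by positivity))
  set F := ∑ j, |f j| with hF
  have hF0 : 0 ≤ F := Finset.sum_nonneg fun j _ => abs_nonneg _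
  have hfF : ∀ l, |f l| ≤ F := fun l =>
    Finset.single_le_sum (f := fun j => |f j|) (fun j _ => abs_nonneg _) (Finset.mem_univ l)
  have heF : ∀ l, |(e l : ℝ)| ≤ ∑ j, (e j : ℝ) := fun l => by
    rw [Nat.abs_cast]
    exact Finset.single_le_sum (f := fun j => (e j : ℝ)) (fun j _ => Nat.cast_nonneg _)
      (Finset.mem_univ l)
  have he0 : 0 ≤ ∑ j, (e j : ℝ) := Finset.sum_nonneg fun j _ => Nat.cast_nonneg _
  set L := ∑ j, (e j : ℝ) + F + κ with hL
  obtain ⟨m, hm, htensor⟩ := exists_ne_zero_tensor K (ε := κ / 4) (L := 2 * L) (by positivity)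
    (by linarith)
  set δ := κ / (4 * (F + 1)) with hδ
  have hδ0 : 0 < δ := by positivity
  obtain ⟨q, hq⟩ := exists_rapidly_decreasing hE hk
    (fun q => Fintype.card (HomExp (d + 1) (k ^ q))) hδ0 m
  have hr : ∀ h, k ^ q h ≠ 0 := fun h => (pow_pos hk0 _).ne'
  choose W hW using fun h => exists_jet_eq_sum (R := ℝ) (k ^ q h) B
  obtain ⟨z, hz0, hze, hzf⟩ := htensor (fun h => HomExp (d + 1) (k ^ q h))
    (fun h => HomExp.dev fun j => (e j : ℝ)) (fun h => HomExp.dev f)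
    (fun h => HomExp.abs_dev_le (Nat.succ_ne_zero d) (hr h) fun l => (heF l).trans (by linarith))
    (fun h => HomExp.abs_dev_le (Nat.succ_ne_zero d) (hr h) fun l => (hfF l).trans (by linarith))
    (fun h => HomExp.sum_dev (Nat.succ_ne_zero d) (hr h) _)
    (fun h => HomExp.sum_dev (Nat.succ_ne_zero d) (hr h) _) W
  have hweight : ∀ (w : Fin (d + 1) → ℝ) (J : ∀ h, HomExp (d + 1) (k ^ q h)),
      ¬ (m * (κ / 4) < ∑ h, (J h).dev w) →
      ∑ h, (∑ j, w j * (J h).1 j) / ((k ^ q h : ℕ) : ℝ) ≤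
        m * ((∑ j, w j) / (d + 1 : ℕ) + κ / 4) := by
    intro w J hJ
    simp only [HomExp.dev, Finset.sum_sub_distrib, Finset.sum_const, Finset.card_univ,
      Fintype.card_fin, nsmul_eq_mul] at hJ
    rw [mul_add]
    linarith [not_lt.1 hJ]
  let ℓ : ∀ h : Fin m, ℕ → ℕ → (Fin d → Fin (k ^ q h + 1)) → HomExp (d + 1) (k ^ q h) → ℚ :=
    fun h t i s a =>
      (jet (Pi.single 0 1) (fun l => ∑ j, (s j : ℚ) * g (t - q h) j l) a.1).coeff i
  have hD : ∀ h, ∀ᶠ t in U, t - q h ∈ D := fun h => hED _ (hq h).1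
  have hnd : ∀ h (l : ℕ) (w : Fin l → HomExp (d + 1) (k ^ q h) → ℚ), ∀ᶠ t in U,
      ∀ x ∈ Submodule.span ℚ (Set.range w), x ≠ 0 → ∃ i < l, ∃ s, ∑ a, x a * ℓ h t i s a ≠ 0 := by
    intro h l w
    obtain ⟨Z, hZ, hZ'⟩ := exists_finite_exists_jet_ne_zero w
    have h1 : ∀ᶠ t in U, ∀ a ∈ Z, t - q h ∈ D → A (t - q h) ≠ a := by
      rw [Filter.eventually_all_finite hZ]
      intro a _
      exact hU ((Filter.tendsto_sub_atTop_nat _).eventually (hA a))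
    filter_upwards [h1, hD h] with t ht htD
    exact hZ' (A (t - q h)) (g (t - q h)) (fun hmem => ht _ hmem htD rfl) (hg _ htD) (hdet _ htD)
  have hz0' : (fun J => (z J : ℚ)) ≠ 0 := by
    obtain ⟨J, hJ⟩ := Function.ne_iff.1 hz0
    exact Function.ne_iff.2 ⟨J, Int.cast_ne_zero.2 hJ⟩
  have hV := eventually_exists_sum_mul_prod_ne_zero U (fun h => HomExp (d + 1) (k ^ q h))
    (fun h => Fin d → Fin (k ^ q h + 1)) ℓ hnd _ hz0'
  set c₂ := ∑ l, |M l 0| with hc₂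
  have hc₂0 : 0 ≤ c₂ := Finset.sum_nonneg fun l _ => abs_nonneg _
  let y : (∀ h, HomExp (d + 1) (k ^ q h)) → ℝ := fun J' =>
    ∑ J, (z J : ℝ) * ∏ h, (W h (J h) (J' h) : ℝ)
  have hy : ∀ J', y J' ≠ 0 → ∑ h, (∑ j, f j * (J' h).1 j) / ((k ^ q h : ℕ) : ℝ) ≤
      m * (μf + κ / 4) := by
    intro J' hJ'
    refine hweight f J' fun hlt => hJ' ?_
    have := congrArg (algebraMap K ℝ) (hzf J' hlt)
    simpa [y] using this
  have hze' : ∀ J, z J ≠ 0 → ∑ h, (∑ j, (e j : ℝ) * (J h).1 j) / ((k ^ q h : ℕ) : ℝ) ≤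
      m * (μe + κ / 4) := fun J hJ => hweight _ J fun hlt => hJ (hze J hlt)
  let C : Fin m → ℝ := fun h => (d * (k ^ q h : ℕ) * c + c₂) ^ (k ^ q h)
  have hC0 : ∀ h, 0 ≤ C h := fun h => by positivity
  set T := ∑ J, |y J| * ∏ h, C h with hT
  have hκm : 0 < m * (κ / 4) := by positivity
  have hsmall : ∀ᶠ t : ℕ in U, T * (b : ℝ) ^ (-((k : ℝ) ^ t * (m * (κ / 4)))) < 1 := by
    refine hU ?_
    have h1 : Filter.Tendsto (fun t : ℕ => T * (b : ℝ) ^ (-((k : ℝ) ^ t * (m * (κ / 4)))))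
        Filter.atTop (nhds (T * 0)) := by
      refine Filter.Tendsto.const_mul _ ?_
      have h2 : Filter.Tendsto (fun t : ℕ => -((k : ℝ) ^ t * (m * (κ / 4)))) Filter.atTop
          Filter.atBot := Filter.tendsto_neg_atTop_atBot.comp
        ((tendsto_pow_atTop_atTop_of_one_lt hk1).atTop_mul_const hκm)
      exact (tendsto_rpow_atBot_of_base_gt_one _ hb1).comp h2
    rw [mul_zero] at h1
    exact h1.eventually_lt_const one_pos
  have hqt : ∀ᶠ t in U, ∀ h, q h ≤ t :=
    Filter.eventually_all.2 fun h => hU (Filter.eventually_ge_atTop _)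
  obtain ⟨t, ⟨⟨⟨I, s, hI, hVt⟩, hsmall⟩, hqt⟩, hD⟩ :=
    (((hV.and hsmall).and hqt).and (Filter.eventually_all.2 hD)).exists
  have hlow := one_le_abs_sum_mul_prod_mul_rpow (θ := m * (μe + κ / 4)) hk0 hb0' hqt z
    (fun h => ℓ h t (I h) (s h)) e ?_ (by positivity) hze' hVt
  swap
  · intro h a
    refine exists_int_jet_coeff_mul (fun j => ?_) (fun j => ?_) a.1 (I h)
    · refine ⟨Pi.single (M := fun _ => ℤ) 0 1 j * b ^ (k ^ (t - q h) * e j), ?_⟩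
      rcases eq_or_ne j 0 with rfl | hj
      · simp
      · simp [hj]
    · choose p hp using fun i => hint _ (hD h) i j
      refine ⟨∑ i, (s h i : ℕ) * p i, ?_⟩
      rw [Finset.sum_mul]
      push_cast
      exact Finset.sum_congr rfl fun i _ => by rw [mul_assoc, hp]
  let u' : Fin (d + 1) → ℝ := fun l => ∑ j, M l j * (Pi.single 0 1 : Fin (d + 1) → ℝ) j
  let v' : Fin m → Fin (d + 1) → ℝ := fun h l =>
    ∑ j, M l j * ∑ i, (s h i : ℝ) * (g (t - q h) i j : ℝ)
  have hℓ : ∀ h a, (ℓ h t (I h) (s h) a : ℝ) =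
      ∑ a', (W h a a' : ℝ) * (jet u' (v' h) a'.1).coeff (I h) := by
    intro h a
    have h1 := congrArg (fun p => p.coeff (I h)) (hW h u' (v' h) a)
    simp only [Polynomial.finsetSum_coeff, Polynomial.coeff_C_mul] at h1
    refine Eq.trans ?_ h1
    have h2 : (ℓ h t (I h) (s h) a : ℝ) = ((jet (Pi.single 0 1)
      (fun l => ∑ j, (s h j : ℚ) * g (t - q h) j l) a.1).map (algebraMap ℚ ℝ)).coeff (I h) := by
      rw [Polynomial.coeff_map]
      rfl
    rw [h2, map_jet]
    congr 3
    · funext j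
      refine Eq.trans ?_ (hB _ j).symm
      rcases eq_or_ne j 0 with rfl | hj
      · simp
      · simp [hj]
    · funext j
      refine Eq.trans ?_ (hB _ j).symm
      simp
  have hVeq : ((∑ J, z J * ∏ h, ℓ h t (I h) (s h) (J h) : ℚ) : ℝ) =
      ∑ J', y J' * ∏ h, (jet u' (v' h) (J' h).1).coeff (I h) := by
    push_cast
    simp only [hℓ, Finset.prod_univ_sum, Fintype.piFinset_univ, y, Finset.mul_sum,
      Finset.sum_mul, Finset.prod_mul_distrib]
    rw [Finset.sum_comm]
    exact Finset.sum_congr rfl fun J' _ => Finset.sum_congr rfl fun J _ => by ring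
  have hup := abs_sum_mul_prod_le (θ := m * (μf + κ / 4)) (δ := δ) (F := F) (f := f) (C := C)
    (I := I) hk0 hb0' hqt y
    (fun h a => (jet u' (v' h) a.1).coeff (I h)) hF0 hC0
    (fun h => le_trans (by exact_mod_cast (hI h).le) (hq h).2) ?_ hy
  swap
  · intro h a
    refine abs_jet_coeff_le (Real.one_le_rpow hb1.le (by positivity)) (by positivity) hc₂0
      (fun l => ?_) (fun l => ?_) (fun l => (abs_le.1 (hfF l)).1) a (I h)
    · have h1 : v' h l = ∑ i, (s h i : ℝ) * ∑ j, M l j * (g (t - q h) i j : ℝ) := by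
        simp only [v', Finset.mul_sum]
        rw [Finset.sum_comm]
        exact Finset.sum_congr rfl fun i _ => Finset.sum_congr rfl fun j _ => by ring
      rw [h1]
      refine (Finset.abs_sum_le_sum_abs _ _).trans ?_
      calc ∑ i, |(s h i : ℝ) * ∑ j, M l j * (g (t - q h) i j : ℝ)|
          ≤ ∑ i : Fin d, ((k ^ q h : ℕ) : ℝ) *
              (c * ((b : ℝ) ^ ((k : ℝ) ^ (t - q h))) ^ f l) := by
            refine Finset.sum_le_sum fun i _ => ?_
            rw [abs_mul, Nat.abs_cast]
            exact mul_le_mul (by exact_mod_cast Fin.is_le _) (hf _ (hD h) i l) (abs_nonneg _)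
              (Nat.cast_nonneg _)
        _ = _ := by
            rw [Finset.sum_const, Finset.card_univ, Fintype.card_fin, nsmul_eq_mul]
            ring
    · have h1 : u' l = M l 0 := by simp [u', Pi.single_apply]
      rw [h1]
      exact Finset.single_le_sum (f := fun l => |M l 0|) (fun l _ => abs_nonneg _)
        (Finset.mem_univ l)
  rw [hVeq] at hlow
  have hb0 : (0 : ℝ) < b := one_pos.trans hb1
  have hT0 : 0 ≤ T := Finset.sum_nonneg fun J _ =>
    mul_nonneg (abs_nonneg _) (Finset.prod_nonneg fun h _ => hC0 h)
  have hFδ : F * δ ≤ κ / 4 := by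
    rw [hδ, mul_div_assoc', div_le_div_iff₀ (by positivity) (by positivity)]
    nlinarith
  have hfin : 1 ≤ T * (b : ℝ) ^ (-((k : ℝ) ^ t * (m * (κ / 4)))) := by
    refine hlow.trans ((mul_le_mul_of_nonneg_right hup (by positivity)).trans ?_)
    rw [mul_assoc, ← Real.rpow_add hb0]
    refine mul_le_mul_of_nonneg_left (Real.rpow_le_rpow_of_exponent_le hb1.le ?_) hT0
    rw [← mul_add, ← mul_neg]
    refine mul_le_mul_of_nonneg_left ?_ (by positivity)
    have h1 : μf = -κ - μe := by linarith
    rw [h1]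
    have h2 : (0 : ℝ) ≤ m := Nat.cast_nonneg _
    nlinarith [mul_le_mul_of_nonneg_left hFδ h2]
  exact absurd hsmall (not_lt.2 hfin)

/-- Equivalent configurations force the output word to repeat a block of length `k ^ t`. -/
theorem foldl_digits_mul_pow_add {C : Type*} {k : ℕ} (hk : 2 ≤ k) {init : C} {step : C → ℕ → C}
    {out : C → ℕ} {a : ℕ → ℕ}
    (ha : ∀ n : ℕ, 1 ≤ n → a n = out (List.foldl step init ((Nat.digits k n).reverse)))
    {n n' : ℕ} (hn : 1 ≤ n) (hn' : 1 ≤ n')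
    (hequiv : ∀ w : List ℕ, (∀ d ∈ w, d < k) →
      out (List.foldl step (List.foldl step init ((Nat.digits k n).reverse)) w) =
        out (List.foldl step (List.foldl step init ((Nat.digits k n').reverse)) w))
    {t r : ℕ} (hr : r < k ^ t) : a (n * k ^ t + r) = a (n' * k ^ t + r) := by
  have hlen : (Nat.digits k r).length ≤ t := (Nat.digits_length_le_iff hk r).2 hr
  set w := (Nat.digits k r ++ List.replicate (t - (Nat.digits k r).length) 0) with hw
  have key : ∀ N, 1 ≤ N → Nat.digits k (N * k ^ t + r) = w ++ Nat.digits k N := fun N hN => by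
    rw [hw, Nat.digits_append_zeroes_append_digits hk hN, add_comm, mul_comm]
    congr 4
    omega
  have hpos : 0 < k ^ t := by positivity
  rw [ha _ (by nlinarith), ha _ (by nlinarith), key n hn, key n' hn']
  simp only [List.reverse_append, List.foldl_append]
  simpa only [hw, List.reverse_append, List.foldl_append] using hequiv w.reverse fun d hd => by
    rw [List.mem_reverse, hw, List.mem_append] at hd
    rcases hd with hd | hd
    · exact Nat.digits_lt_base hk hd
    · rw [List.eq_of_mem_replicate hd]; omega

theorem exists_int_pow_mul_ofDigits_sub {b : ℕ} (hb : 1 ≤ b) (u : ℕ → Fin b) (m : ℕ) :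
    ∃ z : ℤ, (b : ℝ) ^ m * Real.ofDigits u = z + Real.ofDigits fun i => u (i + m) := by
  refine ⟨∑ i ∈ Finset.range m, (u i : ℤ) * b ^ (m - (i + 1)), ?_⟩
  have hb' : (b : ℝ) ≠ 0 := by positivity
  rw [Real.ofDigits_eq_sum_add_ofDigits u m, mul_add, ← mul_assoc,
    mul_inv_cancel₀ (pow_ne_zero _ hb'), one_mul, Finset.mul_sum]
  push_cast
  congr 1
  refine Finset.sum_congr rfl fun i hi => ?_
  have h : m = m - (i + 1) + (i + 1) := by have := Finset.mem_range.1 hi; omega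
  rw [Real.ofDigitsTerm, mul_left_comm]
  congr 1
  nth_rw 1 [h]
  rw [pow_add, mul_assoc, mul_inv_cancel₀ (pow_ne_zero _ hb'), mul_one]

/-- A repeated digit block of length `k ^ t` gives a good approximation to a multiple of the number. -/
theorem exists_int_abs_sub_le {k b : ℕ} (hb : 2 ≤ b) (hk : 1 ≤ k) {a : ℕ → ℕ} (hdig : ∀ n, a n < b)
    {n n' : ℕ} (h : ∀ t r, r < k ^ t → a (n * k ^ t + r) = a (n' * k ^ t + r)) (t : ℕ) :
    ∃ p : ℤ, |(((b : ℝ) ^ k ^ t) ^ n' - ((b : ℝ) ^ k ^ t) ^ n) *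
      (∑' i : ℕ, (a (i + 1) : ℝ) / (b : ℝ) ^ (i + 1)) - p| ≤ b / (b : ℝ) ^ k ^ t := by
  set u : ℕ → Fin b := fun i => ⟨a (i + 1), hdig _⟩ with hu
  have hξ : (∑' i : ℕ, (a (i + 1) : ℝ) / (b : ℝ) ^ (i + 1)) = Real.ofDigits u := by
    simp only [Real.ofDigits, Real.ofDigitsTerm, hu, div_eq_mul_inv]
  obtain ⟨z, hz⟩ := exists_int_pow_mul_ofDigits_sub (by omega) u (k ^ t * n)
  obtain ⟨z', hz'⟩ := exists_int_pow_mul_ofDigits_sub (by omega) u (k ^ t * n')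
  refine ⟨z' - z, ?_⟩
  have hpos : 0 < k ^ t := by positivity
  have := Real.abs_ofDigits_sub_ofDigits_le (x := fun i => u (i + k ^ t * n'))
    (y := fun i => u (i + k ^ t * n)) (n := k ^ t - 1) fun i hi => by
      simp only [hu, Fin.mk.injEq]
      have := h t (i + 1) (by omega)
      rw [show i + k ^ t * n' + 1 = n' * k ^ t + (i + 1) by ring,
        show i + k ^ t * n + 1 = n * k ^ t + (i + 1) by ring, this]
  rw [hξ, ← pow_mul, ← pow_mul, sub_mul, hz, hz']
  have hb' : (b : ℝ) ≠ 0 := by positivity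
  calc _ = |Real.ofDigits (fun i => u (i + k ^ t * n')) - Real.ofDigits fun i => u (i + k ^ t * n)| := by
        push_cast; congr 1; ring
    _ ≤ _ := this
    _ = _ := by
        obtain ⟨m, hm⟩ : ∃ m, k ^ t = m + 1 := ⟨k ^ t - 1, by omega⟩
        rw [hm, Nat.add_sub_cancel, pow_succ]
        field_simp

theorem tendsto_pow_pow_atTop {k b : ℕ} (hk : 2 ≤ k) (hb : 2 ≤ b) :
    Filter.Tendsto (fun t : ℕ => (b : ℝ) ^ k ^ t) Filter.atTop Filter.atTop :=
  (tendsto_pow_atTop_atTop_of_one_lt (by exact_mod_cast hb)).comp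
    (tendsto_pow_atTop_atTop_of_one_lt (by exact_mod_cast hk))

theorem rpow_natCast_pow (k b t : ℕ) : (b : ℝ) ^ ((k : ℝ) ^ t) = (b : ℝ) ^ k ^ t := by
  rw [← Nat.cast_pow, Real.rpow_natCast]

/-- Irrational elements of `K` have no family of very good rational approximations whose
denominators are essentially `b`-powers. -/
theorem false_of_good_rational_approximations (K : IntermediateField ℚ ℝ) [FiniteDimensional ℚ K]
    {k b n : ℕ} (hk : 2 ≤ k) (hb : 2 ≤ b) (α : K) (hα : Irrational α)
    (U : Filter ℕ) [U.NeBot] (hU : U ≤ Filter.atTop) {E D : Set ℕ} (hE : E.Infinite)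
    (hED : ∀ q ∈ E, ∀ᶠ t in U, t - q ∈ D)
    (hD : ∀ t ∈ D, ∃ r : ℚ, (r.den : ℝ) ≤ ((b : ℝ) ^ k ^ t) ^ (1 / 3 : ℝ) ∧
      r.den * |((b : ℝ) ^ k ^ t) ^ n * α - r| ≤ ((b : ℝ) ^ k ^ t) ^ (-1 / 2 : ℝ)) : False := by
  have hD' : ∀ t, ∃ r : ℚ, t ∈ D → (r.den : ℝ) ≤ ((b : ℝ) ^ k ^ t) ^ (1 / 3 : ℝ) ∧
      r.den * |((b : ℝ) ^ k ^ t) ^ n * α - r| ≤ ((b : ℝ) ^ k ^ t) ^ (-1 / 2 : ℝ) := fun t => by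
    by_cases h : t ∈ D
    · obtain ⟨r, hr⟩ := hD t h; exact ⟨r, fun _ => hr⟩
    · exact ⟨0, fun h' => (h h').elim⟩
  choose r hr using hD'
  have hx1 : ∀ t, 1 ≤ (b : ℝ) ^ k ^ t := fun t => one_le_pow₀ (by exact_mod_cast (by omega : 1 ≤ b))
  have hb0 : (b : ℚ) ≠ 0 := by positivity
  have s2 : ∀ F : Fin (1 + 1) → ℝ, ∑ j, F j = F 0 + F 1 := Fin.sum_univ_two
  refine false_of_approximation_family K (d := 1) hk hb ![n, 0] ![-n - 1 / 2, 1 / 3] ?_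
    ![![1, -α], ![0, 1]] ![![1, α], ![0, 1]] ?_ U hU hE hED
    (fun t _ => ![(r t).num / (b : ℚ) ^ (k ^ t * n), (r t).den])
    (fun t _ => r t / (b : ℚ) ^ (k ^ t * n)) zero_le_one ?_ ?_ ?_ ?_ ?_
  · simp only [s2]
    simp only [Matrix.cons_val_zero, Matrix.cons_val_one]
    push_cast
    linarith
  · intro y j
    simp only [s2]
    fin_cases j <;> simp
  · intro t _ j
    simp only [Fin.sum_univ_one]
    simp [div_mul_eq_mul_div, Rat.mul_den_eq_num]
  · intro t _
    simp
  · intro t _ i j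
    fin_cases j
    · exact ⟨(r t).num, by simp [hb0]⟩
    · exact ⟨(r t).den, by simp⟩
  · intro t ht i l
    obtain ⟨h1, h2⟩ := hr t ht
    have hx := hx1 t
    rw [rpow_natCast_pow]
    simp only [s2]
    fin_cases l
    · simp only [Fin.zero_eta, Matrix.cons_val_zero, Matrix.cons_val_one, one_mul]
      push_cast
      rw [pow_mul]
      set x := (b : ℝ) ^ k ^ t
      have hx0 : 0 < x := by linarith
      have e1 : x ^ (-n - 1 / 2 : ℝ) = x ^ (-1 / 2 : ℝ) / x ^ n := by
        rw [← Real.rpow_natCast, ← Real.rpow_sub hx0]; congr 1; ring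
      have e2 : ((r t).num : ℝ) = r t * (r t).den := by
        exact_mod_cast (Rat.mul_den_eq_num (r t)).symm
      rw [e1, le_div_iff₀ (by positivity), e2]
      refine le_trans (le_of_eq ?_) h2
      rw [abs_sub_comm, ← abs_of_pos (pow_pos hx0 n), ← abs_mul, abs_of_pos (pow_pos hx0 n),
        ← abs_of_nonneg (Nat.cast_nonneg (α := ℝ) (r t).den), ← abs_mul,
        abs_of_nonneg (Nat.cast_nonneg (α := ℝ) (r t).den)]
      congr 1
      field_simp
      ring
    · simpa using h1
  · intro a
    have hne : 0 < |(α : ℝ) - a 0| := abs_pos.2 (sub_ne_zero.2 (hα.ne_rat _))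
    have hlim := ((tendsto_rpow_neg_atTop (y := 1 / 2) (by norm_num)).comp
      (tendsto_pow_pow_atTop hk hb)).eventually (gt_mem_nhds hne)
    filter_upwards [hlim] with t ht htD hat
    obtain ⟨h1, h2⟩ := hr t htD
    have hx := hx1 t
    have hq : a 0 = r t / (b : ℚ) ^ (k ^ t * n) := by rw [← hat]
    rw [hq] at ht
    push_cast at ht
    rw [pow_mul] at ht
    simp only [Function.comp] at ht
    set x := (b : ℝ) ^ k ^ t
    have hx0 : 0 < x := by linarith
    have hxn : 1 ≤ x ^ n := one_le_pow₀ hx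
    have hden : (1 : ℝ) ≤ (r t).den := by exact_mod_cast (r t).pos
    have h3 : |x ^ n * α - r t| ≤ x ^ (-1 / 2 : ℝ) :=
      (le_mul_of_one_le_left (abs_nonneg _) hden).trans h2
    have h4 : |α - r t / x ^ n| ≤ |x ^ n * α - r t| := by
      refine (le_mul_of_one_le_left (abs_nonneg _) hxn).trans (le_of_eq ?_)
      rw [← abs_of_pos (pow_pos hx0 n), ← abs_mul, abs_of_pos (pow_pos hx0 n)]
      congr 1
      field_simp
    rw [neg_div] at h3
    linarith

theorem exists_rat_den_le_and_den_mul_abs_sub_lt (θ : ℝ) {y : ℝ} (hy : 1 ≤ y) :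
    ∃ r : ℚ, (r.den : ℝ) ≤ y ∧ r.den * |θ - r| < y⁻¹ := by
  obtain ⟨r, h1, h2⟩ := Real.exists_rat_abs_sub_le_and_den_le θ (Nat.floor_pos.2 hy)
  have hden : (0 : ℝ) < r.den := by exact_mod_cast r.pos
  refine ⟨r, (Nat.cast_le.2 h2).trans (Nat.floor_le (by linarith)), ?_⟩
  rw [le_div_iff₀ (by positivity)] at h1
  have hlt := Nat.lt_floor_add_one y
  calc _ ≤ (⌊y⌋₊ + 1 : ℝ)⁻¹ := by
        rw [← one_div, le_div_iff₀ (by positivity)]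
        linarith
    _ < _ := inv_strictAnti₀ (by linarith) hlt

theorem exists_two_rat_den_mul_abs_sub_le {θ x : ℝ} (hx : 1 ≤ x)
    (h : ∀ r : ℚ, (r.den : ℝ) ≤ x ^ (1 / 3 : ℝ) → x ^ (-1 / 2 : ℝ) < r.den * |θ - r|) :
    ∃ r : Fin 2 → ℚ, r 0 ≠ r 1 ∧ ∀ i, ((r i).den : ℝ) ≤ x ^ (1 / 2 : ℝ) ∧
      (r i).den * |θ - r i| ≤ x ^ (-1 / 3 : ℝ) := by
  have hx0 : 0 < x := by linarith
  obtain ⟨r, hr, hr'⟩ := exists_rat_den_le_and_den_mul_abs_sub_lt θ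
    (Real.one_le_rpow hx (z := 1 / 3) (by norm_num))
  obtain ⟨s, hs, hs'⟩ := exists_rat_den_le_and_den_mul_abs_sub_lt θ
    (Real.one_le_rpow hx (z := 1 / 2) (by norm_num))
  rw [← Real.rpow_neg hx0.le, ← neg_div] at hr' hs'
  refine ⟨![r, s], fun hrs => ?_, fun i => ?_⟩
  · simp only [Matrix.cons_val_zero, Matrix.cons_val_one] at hrs
    exact (h r hr).not_gt (hrs ▸ hs')
  · fin_cases i
    · exact ⟨hr.trans (Real.rpow_le_rpow_of_exponent_le hx (by norm_num)), hr'.le⟩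
    · exact ⟨hs, hs'.le.trans (Real.rpow_le_rpow_of_exponent_le hx (by norm_num))⟩

/-- Without very good rational approximations to `b ^ (k ^ t * n) * α`, two Dirichlet approximations
span a plane to which `false_of_approximation_family` applies. -/
theorem false_of_no_good_rational_approximations (K : IntermediateField ℚ ℝ)
    [FiniteDimensional ℚ K] {k b n n' : ℕ} (hk : 2 ≤ k) (hb : 2 ≤ b) (hn : n < n') (α : K)
    (p : ℕ → ℤ) (hp : ∀ t, |(((b : ℝ) ^ k ^ t) ^ n' - ((b : ℝ) ^ k ^ t) ^ n) * α - p t| ≤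
      b / (b : ℝ) ^ k ^ t)
    (U : Filter ℕ) [U.NeBot] (hU : U ≤ Filter.atTop) {E D : Set ℕ} (hE : E.Infinite)
    (hED : ∀ q ∈ E, ∀ᶠ t in U, t - q ∈ D)
    (hD : ∀ t ∈ D, ∀ r : ℚ, (r.den : ℝ) ≤ ((b : ℝ) ^ k ^ t) ^ (1 / 3 : ℝ) →
      ((b : ℝ) ^ k ^ t) ^ (-1 / 2 : ℝ) < r.den * |((b : ℝ) ^ k ^ t) ^ n * α - r|) : False := by
  have hx1 : ∀ t, 1 ≤ (b : ℝ) ^ k ^ t := fun t => one_le_pow₀ (by exact_mod_cast (by omega : 1 ≤ b))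
  have hb0 : (b : ℚ) ≠ 0 := by positivity
  have hD' : ∀ t, ∃ r : Fin 2 → ℚ, t ∈ D → r 0 ≠ r 1 ∧ ∀ i,
      ((r i).den : ℝ) ≤ ((b : ℝ) ^ k ^ t) ^ (1 / 2 : ℝ) ∧
      (r i).den * |((b : ℝ) ^ k ^ t) ^ n * α - r i| ≤ ((b : ℝ) ^ k ^ t) ^ (-1 / 3 : ℝ) := fun t => by
    by_cases h : t ∈ D
    · obtain ⟨r, hr⟩ := exists_two_rat_den_mul_abs_sub_le (hx1 t) (hD t h)
      exact ⟨r, fun _ => hr⟩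
    · exact ⟨0, fun h' => (h h').elim⟩
  choose r hr using hD'
  have s3 : ∀ F : Fin (2 + 1) → ℝ, ∑ j, F j = F 0 + F 1 + F 2 := Fin.sum_univ_three
  refine false_of_approximation_family K (d := 2) hk hb ![n', n, 0]
    ![-n' - 1 / 3, -n - 1 / 3, 1 / 2] ?_ ![![1, 0, α], ![0, 1, -α], ![0, 0, 1]]
    ![![1, 0, -α], ![0, 1, α], ![0, 0, 1]] ?_ U hU hE hED
    (fun t i => ![-((r t i).num + p t * (r t i).den) / (b : ℚ) ^ (k ^ t * n'),
      (r t i).num / (b : ℚ) ^ (k ^ t * n), (r t i).den])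
    (fun t => ![-((b : ℚ) ^ (k ^ t * n) / (b : ℚ) ^ (k ^ t * n')),
      -(p t / (b : ℚ) ^ (k ^ t * n'))]) (c := 1 + b) (by positivity) ?_ ?_ ?_ ?_ ?_
  · simp only [s3, Matrix.cons_val]
    push_cast
    linarith
  · intro y j
    simp only [s3]
    fin_cases j <;> simp
  · intro t _ j
    simp only [Fin.sum_univ_two, Matrix.cons_val, Fin.succ_zero_eq_one, Fin.succ_one_eq_two]
    field_simp
    ring
  · intro t ht
    rw [Matrix.det_fin_two]
    simp only [Matrix.of_apply, Matrix.cons_val, Fin.succ_zero_eq_one, Fin.succ_one_eq_two]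
    intro h0
    refine (hr t ht).1 ?_
    rw [← Rat.num_div_den (r t 0), ← Rat.num_div_den (r t 1), div_eq_div_iff (by simp) (by simp)]
    field_simp at h0
    linarith
  · intro t _ i j
    fin_cases j
    · exact ⟨-((r t i).num + p t * (r t i).den), by simp [hb0]⟩
    · exact ⟨(r t i).num, by simp [hb0]⟩
    · exact ⟨(r t i).den, by simp⟩
  · intro t ht i l
    obtain ⟨h1, h2⟩ := (hr t ht).2 i
    have hx := hx1 t
    have h3 := hp t
    rw [rpow_natCast_pow]
    simp only [s3]
    set q := r t i
    have e2 : (q.num : ℝ) = q * q.den := by exact_mod_cast (Rat.mul_den_eq_num q).symm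
    have hden : (0 : ℝ) ≤ q.den := Nat.cast_nonneg _
    have e3 : ∀ z : ℝ, q.den * |z - q| = |q.num - q.den * z| := fun z => by
      rw [e2, abs_sub_comm, ← abs_of_nonneg hden, ← abs_mul, abs_of_nonneg hden]
      congr 1; ring
    rw [e3] at h2
    have e1 : ∀ y : ℝ, 0 < y → ∀ m : ℕ, y ^ (-m - 1 / 3 : ℝ) = y ^ (-1 / 3 : ℝ) / y ^ m :=
      fun y hy m => by
        rw [← Real.rpow_natCast, ← Real.rpow_sub hy]
        congr 1
        ring
    fin_cases l
    · simp only [Fin.zero_eta, Matrix.cons_val]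
      push_cast
      rw [e1 _ (by linarith), pow_mul, pow_mul]
      set x := (b : ℝ) ^ k ^ t
      have hx0 : 0 < x := by linarith
      rw [← mul_div_assoc (1 + (b : ℝ)), le_div_iff₀ (by positivity)]
      have e4 : q.den * (b / x) ≤ b * x ^ (-1 / 3 : ℝ) := by
        have : x ^ (1 / 2 : ℝ) / x ≤ x ^ (-1 / 3 : ℝ) := by
          nth_rw 2 [← Real.rpow_one x]
          rw [← Real.rpow_sub hx0]
          exact Real.rpow_le_rpow_of_exponent_le hx (by norm_num)
        calc _ = b * (q.den / x) := by ring
          _ ≤ b * (x ^ (1 / 2 : ℝ) / x) := by gcongr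
          _ ≤ _ := by gcongr
      calc _ = |-(q.num - q.den * (x ^ n * α)) + q.den * ((x ^ n' - x ^ n) * α - p t)| := by
            rw [← abs_of_pos (pow_pos hx0 n'), ← abs_mul, abs_of_pos (pow_pos hx0 n')]
            congr 1
            field_simp
            ring
        _ ≤ |q.num - q.den * (x ^ n * α)| + q.den * |(x ^ n' - x ^ n) * α - p t| := by
            refine (abs_add_le _ _).trans (le_of_eq ?_)
            rw [abs_neg, abs_mul, abs_of_nonneg hden]
        _ ≤ x ^ (-1 / 3 : ℝ) + q.den * (b / x) := by gcongr
        _ ≤ _ := by linarith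
    · simp only [Fin.mk_one, Matrix.cons_val]
      push_cast
      rw [e1 _ (by linarith), pow_mul, pow_mul]
      set x := (b : ℝ) ^ k ^ t
      have hx0 : 0 < x := by linarith
      rw [← mul_div_assoc (1 + (b : ℝ)), le_div_iff₀ (by positivity)]
      have hc : x ^ (-1 / 3 : ℝ) ≤ (1 + b) * x ^ (-1 / 3 : ℝ) :=
        le_mul_of_one_le_left (by positivity) (by simp)
      refine le_trans (le_of_eq ?_) (h2.trans hc)
      rw [← abs_of_pos (pow_pos hx0 n), ← abs_mul, abs_of_pos (pow_pos hx0 n)]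
      congr 1
      field_simp
      ring
    · simp only [Fin.reduceFinMk, Matrix.cons_val]
      push_cast
      rw [zero_mul, zero_mul, zero_add, zero_add, one_mul, abs_of_nonneg hden]
      exact h1.trans (le_mul_of_one_le_left (by positivity) (by simp))
  · intro a
    filter_upwards [(tendsto_pow_pow_atTop hk hb).eventually_gt_atTop (-((a 0 : ℚ) : ℝ)⁻¹)]
      with t ht _ hat
    have hx := hx1 t
    have hq : a 0 = -((b : ℚ) ^ (k ^ t * n) / (b : ℚ) ^ (k ^ t * n')) := by rw [← hat]; rfl
    rw [hq] at ht
    push_cast at ht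
    rw [pow_mul, pow_mul, inv_neg, neg_neg, inv_div] at ht
    set x := (b : ℝ) ^ k ^ t
    have hx0 : 0 < x := by linarith
    rw [div_lt_iff₀ (by positivity), ← pow_succ'] at ht
    exact ht.not_ge (pow_le_pow_right₀ hx hn)

theorem false_of_isAlgebraic_of_irrational {k b n n' : ℕ} (hk : 2 ≤ k) (hb : 2 ≤ b) (hn : n < n')
    {ξ : ℝ} (hξ : IsAlgebraic ℚ ξ) (hirr : Irrational ξ)
    (hp : ∀ t : ℕ, ∃ p : ℤ, |(((b : ℝ) ^ k ^ t) ^ n' - ((b : ℝ) ^ k ^ t) ^ n) * ξ - p| ≤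
      b / (b : ℝ) ^ k ^ t) : False := by
  choose p hp using hp
  have := IntermediateField.adjoin.finiteDimensional hξ.isIntegral
  set K := IntermediateField.adjoin ℚ {ξ}
  let α : K := ⟨ξ, IntermediateField.mem_adjoin_simple_self ℚ ξ⟩
  set U := Filter.hyperfilter ℕ
  have hU : (U : Filter ℕ) ≤ Filter.atTop := Nat.hyperfilter_le_atTop
  set D : Set ℕ := {t | ∃ r : ℚ, (r.den : ℝ) ≤ ((b : ℝ) ^ k ^ t) ^ (1 / 3 : ℝ) ∧
    r.den * |((b : ℝ) ^ k ^ t) ^ n * α - r| ≤ ((b : ℝ) ^ k ^ t) ^ (-1 / 2 : ℝ)}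
  by_cases hE : {q : ℕ | ∀ᶠ t in (U : Filter ℕ), t - q ∈ D}.Infinite
  · exact false_of_good_rational_approximations K hk hb α hirr U hU hE (fun q hq => hq)
      fun t ht => ht
  · rw [Set.not_infinite] at hE
    refine false_of_no_good_rational_approximations K hk hb hn α p hp U hU (D := Dᶜ)
      hE.infinite_compl (fun q hq => Ultrafilter.eventually_not.2 hq) fun t ht r hr => ?_
    by_contra! h
    exact ht ⟨r, hr, h⟩

/-- if the base-`b` expansion of `ξ` is produced digitwise by a
deterministic machine (finite-state control with a stack, abstracted by its
configuration space `C`, its extended transition function `step` on input digits,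
and output function `out`) reading base-`k` expansions most significant digit
first, and two distinct positive integers `n, n'` reach equivalent
configurations (no input word can distinguish their outputs), then `ξ` is
rational or transcendental. -/
theorem stmt_8 {C : Type*} (k b : ℕ) (hk : 2 ≤ k) (hb : 2 ≤ b)
    (init : C) (step : C → ℕ → C) (out : C → ℕ)
    (a : ℕ → ℕ) (hdig : ∀ n, a n < b)
    (ha : ∀ n : ℕ, 1 ≤ n →
      a n = out (List.foldl step init ((Nat.digits k n).reverse)))
    (ξ : ℝ) (hξ : ξ = ∑' i : ℕ, (a (i + 1) : ℝ) / (b : ℝ) ^ (i + 1))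
    (n n' : ℕ) (hn : 1 ≤ n) (hlt : n < n')
    (hequiv : ∀ w : List ℕ, (∀ d ∈ w, d < k) →
      out (List.foldl step (List.foldl step init ((Nat.digits k n).reverse)) w) =
        out (List.foldl step (List.foldl step init ((Nat.digits k n').reverse)) w)) :
    (∃ r : ℚ, ξ = (r : ℝ)) ∨ Transcendental ℚ ξ := by
  by_contra! h
  rw [Transcendental, not_not] at h
  subst hξ
  exact false_of_isAlgebraic_of_irrational hk hb hlt h.2
    (fun ⟨r, hr⟩ => h.1 r hr.symm) fun t => exists_int_abs_sub_le hb (by omega) hdig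
      (fun t r hr => foldl_digits_mul_pow_add hk ha hn (by omega) hequiv hr) t
end
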